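/- arXiv:1909.07446 — 3 statements merged into one kernel-verified Lean document; each statement's English description precedes it below -/
import Mathlib

section
/- Let ℍ be an X-net of G with no parallel arcs (no two arcs have the same pair of end-nodes). Then every nonempty set S ⊆ X admits a representative set, that is, a subset R ⊆ S with |R| ≤ 3 such that for every set V ⊆ X, the set R∪V is ℍ-tamed if and only if S∪V is ℍ-tamed. -/
attribute [local instance] Classical.propDecidable

namespace ThreeInATree

variable {V : Type*}

/-- A leaf of a simple graph: a vertex with exactly one neighbor. -/
def IsLeaf (G : SimpleGraph V) (v : V) : Prop := ∃! w, G.Adj v w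

/-- A vertex set inducing a path graph (a tree of maximum degree at most two). -/
def IsPathSet (G : SimpleGraph V) (P : Set V) : Prop :=
  (G.induce P).IsTree ∧
    ∀ v ∈ P, ∀ a ∈ P, ∀ b ∈ P, ∀ c ∈ P,
      G.Adj v a → G.Adj v b → G.Adj v c → a = b ∨ a = c ∨ b = c

/-- `v` is an end-vertex of the path with vertex set `P`: it has at most one
neighbor inside `P`. -/
def IsEndOf (G : SimpleGraph V) (P : Set V) (v : V) : Prop :=
  v ∈ P ∧ ∀ a ∈ P, ∀ b ∈ P, G.Adj v a → G.Adj v b → a = b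

/-- A `UW`-path: either a single vertex in `U ∩ W`, or an (induced) path with one
end-vertex in `U` and the other in `W`. -/
def IsUWPath (G : SimpleGraph V) (U W P : Set V) : Prop :=
  (∃ x, x ∈ U ∧ x ∈ W ∧ P = {x}) ∨
  (IsPathSet G P ∧ ∃ u w, u ≠ w ∧ u ∈ U ∧ w ∈ W ∧ IsEndOf G P u ∧ IsEndOf G P w)

/-- A `UW`-rung of `G[A]`: a vertex-minimal induced `UW`-path inside `A`. -/
def IsRungIn (G : SimpleGraph V) (A U W P : Set V) : Prop :=
  P ⊆ A ∧ IsUWPath G U W P ∧ ∀ Q, Q ⊆ A → IsUWPath G U W Q → P.ncard ≤ Q.ncard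

/-- A sapling: an induced tree containing all (three) leaves of `G`. -/
def IsSapling (G : SimpleGraph V) (T : Set V) : Prop :=
  (G.induce T).IsTree ∧ ∀ v, IsLeaf G v → v ∈ T

def SaplingFree (G : SimpleGraph V) : Prop := ¬ ∃ T, IsSapling G T

/-- A multigraph whose nodes and arcs are vertex sets; each arc `E` has the two
end-nodes `fst E` and `snd E`. -/
structure Net (V : Type*) where
  nodes : Set (Set V)
  arcs : Set (Set V)
  fst : Set V → Set V
  snd : Set V → Set V

namespace Net

/-- The node `N` is an end-node of the arc `E`. -/
def EndsAt (H : Net V) (E N : Set V) : Prop := H.fst E = N ∨ H.snd E = N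

/-- Two nodes joined by some arc. -/
def AdjNodes (H : Net V) (U W : Set V) : Prop :=
  U ≠ W ∧ ∃ E ∈ H.arcs, (H.fst E = U ∧ H.snd E = W) ∨ (H.fst E = W ∧ H.snd E = U)

/-- A leaf node of the net: a node incident to exactly one arc. -/
def IsLeafNode (H : Net V) (N : Set V) : Prop :=
  N ∈ H.nodes ∧ ∃! E, E ∈ H.arcs ∧ H.EndsAt E N

/-- The underlying simple graph of the net on node sets. -/
def graph (H : Net V) : SimpleGraph (Set V) :=
  SimpleGraph.fromRel (fun U W => U ∈ H.nodes ∧ W ∈ H.nodes ∧ H.AdjNodes U W)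

/-- `∇(ℍ)`: the net together with an edge between each pair of its leaf nodes. -/
def nabla (H : Net V) : SimpleGraph (Set V) :=
  SimpleGraph.fromRel (fun U W =>
    (U ∈ H.nodes ∧ W ∈ H.nodes ∧ H.AdjNodes U W) ∨ (H.IsLeafNode U ∧ H.IsLeafNode W))

end Net

/-- A biconnected graph: connected, and still connected after deleting any vertex. -/
def IsBiconnected {α : Type*} (H : SimpleGraph α) : Prop :=
  H.Connected ∧ ∀ v : α, (H.induce {w | w ≠ v}).Connected

/-- Conditions (N1)–(N6): `H` is an `X`-net of `G`. -/
structure IsNet (G : SimpleGraph V) (X : Set V) (H : Net V) : Prop where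
  nodes_sub : ∀ N ∈ H.nodes, N ⊆ X
  fst_mem : ∀ E ∈ H.arcs, H.fst E ∈ H.nodes
  snd_mem : ∀ E ∈ H.arcs, H.snd E ∈ H.nodes
  ends_ne : ∀ E ∈ H.arcs, H.fst E ≠ H.snd E
  conn : (H.graph.induce H.nodes).Connected
  bicon : IsBiconnected (H.nabla.induce H.nodes)
  arcs_nonempty : H.arcs.Nonempty
  arcs_disjoint : ∀ E ∈ H.arcs, ∀ F ∈ H.arcs, E ≠ F → E ∩ F = ∅
  arcs_cover : ⋃₀ H.arcs = X
  leaf_count : {N | H.IsLeafNode N}.ncard = 3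
  leaf_single : ∀ N, H.IsLeafNode N → ∃ v, IsLeaf G v ∧ N = {v}
  rungs : ∀ E ∈ H.arcs, ∀ x ∈ E, ∃ P, x ∈ P ∧ IsRungIn G E (H.fst E) (H.snd E) P
  meets_iff : ∀ E ∈ H.arcs, ∀ N ∈ H.nodes, ((E ∩ N).Nonempty ↔ H.EndsAt E N)
  adj_iff : ∀ E ∈ H.arcs, ∀ F ∈ H.arcs, E ≠ F → ∀ u ∈ E, ∀ v ∈ F,
      (G.Adj u v ↔ ∃ N ∈ H.nodes, H.EndsAt E N ∧ H.EndsAt F N ∧ u ∈ N ∧ v ∈ N)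

/-- An arc `E` is simple if `G[E]` is itself a rung between its end-nodes. -/
def SimpleArc (G : SimpleGraph V) (H : Net V) (E : Set V) : Prop :=
  IsRungIn G E (H.fst E) (H.snd E) E

/-- An `(S,V1,V2)`-sprout inside `G[A]`, of one of the three Types S1, S2, S3. -/
def IsSproutIn (G : SimpleGraph V) (A S V1 V2 T : Set V) : Prop :=
  T ⊆ A ∧
  (((G.induce T).IsTree ∧ (T ∩ S).ncard = 1 ∧ (T ∩ V1).ncard = 1 ∧ (T ∩ V2).ncard = 1) ∨
   (∃ P Q, T = P ∪ Q ∧ P ∩ Q = ∅ ∧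
      IsRungIn G A S V1 P ∧ P ∩ V2 = ∅ ∧ IsRungIn G A S V2 Q ∧ Q ∩ V1 = ∅) ∨
   (∃ P Q, T = P ∪ Q ∧ P ∩ Q = ∅ ∧
      IsRungIn G A V1 V2 P ∧ P ∩ S = ∅ ∧ IsRungIn G A S (V1 ∪ V2) Q))

/-- An arc `E` is flexible if `G[E]` contains an `(S, fst E, snd E)`-sprout for
every nonempty `S ⊆ E`. -/
def FlexibleArc (G : SimpleGraph V) (H : Net V) (E : Set V) : Prop :=
  ∀ S : Set V, S.Nonempty → S ⊆ E → ∃ T, IsSproutIn G E S (H.fst E) (H.snd E) T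

/-- An `X`-web: an `X`-net all of whose arcs are simple or flexible. -/
def IsWeb (G : SimpleGraph V) (X : Set V) (H : Net V) : Prop :=
  IsNet G X H ∧ ∀ E ∈ H.arcs, SimpleArc G H E ∨ FlexibleArc G H E

/-- `{U, W}` is a cutset of `∇(ℍ)` (restricted to the nodes). -/
def Net.CutPairNabla (H : Net V) (U W : Set V) : Prop :=
  U ∈ H.nodes ∧ W ∈ H.nodes ∧ U ≠ W ∧
    Nat.card ((H.nabla.induce (H.nodes \ {U, W})).ConnectedComponent) >
      Nat.card ((H.nabla.induce H.nodes).ConnectedComponent)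

/-- `U` and `W` do not form a cutset of the subgraph `Gs`. -/
def NoCutPair {α : Type*} {Γ : SimpleGraph α} (Gs : Γ.Subgraph) (U W : α) : Prop :=
  Nat.card ((Gs.deleteVerts {U, W}).coe.ConnectedComponent) ≤
    Nat.card (Gs.coe.ConnectedComponent)

/-- `A` is the arc set of a split component of `ℍ` with split pair `{U, W}`:
either a single arc with end-nodes `U` and `W`, or the arcs of a maximal
subgraph `Gs` of `∇(ℍ)` containing the cutset `{U, W}` of `∇(ℍ)` in which `U`
and `W` are nonadjacent and do not form a cutset. -/
def IsSplitCompArcs (H : Net V) (U W : Set V) (A : Set (Set V)) : Prop :=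
  (∃ E ∈ H.arcs, A = {E} ∧
     ((H.fst E = U ∧ H.snd E = W) ∨ (H.fst E = W ∧ H.snd E = U))) ∨
  (H.CutPairNabla U W ∧
   ∃ Gs : (H.nabla).Subgraph,
     U ∈ Gs.verts ∧ W ∈ Gs.verts ∧ ¬ Gs.Adj U W ∧ NoCutPair Gs U W ∧
     (∀ Gs' : (H.nabla).Subgraph, Gs ≤ Gs' → U ∈ Gs'.verts → W ∈ Gs'.verts →
        ¬ Gs'.Adj U W → NoCutPair Gs' U W → Gs' = Gs) ∧
     A = {E | E ∈ H.arcs ∧ Gs.Adj (H.fst E) (H.snd E)})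

/-- `C` is a `UW`-chunk of `ℍ`: the union of the arcs of one or more split
components sharing the split pair `{U, W}`. -/
def IsChunk (H : Net V) (U W : Set V) (C : Set V) : Prop :=
  ∃ 𝒜 : Set (Set (Set V)), 𝒜.Nonempty ∧
    (∀ A ∈ 𝒜, IsSplitCompArcs H U W A) ∧ C = ⋃₀ (⋃₀ 𝒜)

def IsChunkOf (H : Net V) (C : Set V) : Prop := ∃ U W, IsChunk H U W C

/-- A maximal chunk: a chunk not properly contained in any other chunk. -/
def IsMaxChunk (H : Net V) (C : Set V) : Prop :=
  IsChunkOf H C ∧ ∀ C', IsChunkOf H C' → C ⊆ C' → C' = C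

/-- The operation `merge(C)` for a `V1V2`-chunk `C`: replace all arcs meeting `C`
by a single arc `C` with end-nodes `V1, V2`, and delete the nodes all of whose
incident arcs were deleted. -/
noncomputable def Net.merge (H : Net V) (V1 V2 C : Set V) : Net V where
  nodes := {N | N ∈ H.nodes ∧
    ((∃ E ∈ H.arcs, E ∩ C = ∅ ∧ (H.fst E = N ∨ H.snd E = N)) ∨ N = V1 ∨ N = V2)}
  arcs := {E | E ∈ H.arcs ∧ E ∩ C = ∅} ∪ {C}
  fst := fun E => if E = C then V1 else H.fst E
  snd := fun E => if E = C then V2 else H.snd E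

/-- A split pair for the chunk `C` (chosen arbitrarily). -/
noncomputable def chunkEnds (H : Net V) (C : Set V) : Set V × Set V :=
  if h : ∃ p : Set V × Set V, IsChunk H p.1 p.2 C then h.choose else (∅, ∅)

/-- The aiding net `ℍ†` of `ℍ`, obtained by merging every maximal chunk: its arcs
are the maximal chunks of `ℍ` and its nodes are the maximal split nodes of `ℍ`. -/
noncomputable def Net.aiding (H : Net V) : Net V where
  nodes := {N | ∃ C, IsMaxChunk H C ∧ ((chunkEnds H C).1 = N ∨ (chunkEnds H C).2 = N)}
  arcs := {C | IsMaxChunk H C}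
  fst := fun C => (chunkEnds H C).1
  snd := fun C => (chunkEnds H C).2

/-- A set `S ⊆ X` is `ℍ`-tamed: every two of its vertices lie in a common arc or
in a common node of `ℍ`. -/
def Tamed (H : Net V) (S : Set V) : Prop :=
  ∀ u ∈ S, ∀ v ∈ S,
    (∃ E ∈ H.arcs, u ∈ E ∧ v ∈ E) ∨ (∃ N ∈ H.nodes, u ∈ N ∧ v ∈ N)

/-- `N_G(Y, X)`: the neighbors of `Y` inside `X`. -/
def NX (G : SimpleGraph V) (X Y : Set V) : Set V := {x ∈ X | ∃ y ∈ Y, G.Adj y x}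

/-- A set `Y ⊆ V(G) ∖ X` is `ℍ`-tamed if `N(Y) ∩ X` is `ℍ`-tamed. -/
def TamedOut (G : SimpleGraph V) (X : Set V) (H : Net V) (Y : Set V) : Prop :=
  Tamed H (NX G X Y)

/-- `ℍ` is taming: every connected `Y ⊆ V(G) ∖ X` is `ℍ`-tamed. -/
def Taming (G : SimpleGraph V) (X : Set V) (H : Net V) : Prop :=
  ∀ Y : Set V, Y ⊆ Xᶜ → (G.induce Y).Connected → TamedOut G X H Y

/-- An `ℍ`-wild set: a minimally `ℍ`-untamed `Y ⊆ V(G) ∖ X` inducing a path. -/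
def Wild (G : SimpleGraph V) (X : Set V) (H : Net V) (Y : Set V) : Prop :=
  Y ⊆ Xᶜ ∧ IsPathSet G Y ∧ ¬ TamedOut G X H Y ∧ ∀ Z, Z ⊂ Y → TamedOut G X H Z

/-- An `ℍ`-solid subset of `X`: a node of `ℍ`, or a subset `S` of an arc `E`
such that `G[E]` contains no `(S, fst E, snd E)`-sprout. -/
def SolidSet (G : SimpleGraph V) (H : Net V) (S : Set V) : Prop :=
  S ∈ H.nodes ∨
    ∃ E ∈ H.arcs, S ⊆ E ∧ ¬ ∃ T, IsSproutIn G E S (H.fst E) (H.snd E) T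

/-- An `ℍ`-solid set `Y ⊆ V(G) ∖ X` inducing a path: `N(Y) ∩ X` is the union of
two `ℍ`-solid sets and no internal vertex of the path has a neighbor in `X`. -/
def SolidOut (G : SimpleGraph V) (X : Set V) (H : Net V) (Y : Set V) : Prop :=
  (∃ S1 S2, SolidSet G H S1 ∧ SolidSet G H S2 ∧ NX G X Y = S1 ∪ S2) ∧
    ∀ y ∈ Y, ¬ IsEndOf G Y y → NX G X {y} = ∅

/-- `C` is a pod of `Y` in `ℍ`: a `V1V2`-chunk satisfying Conditions P1 and P2. -/
def IsPodOf (G : SimpleGraph V) (X : Set V) (H : Net V) (Y C : Set V) : Prop :=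
  ∃ V1 V2, IsChunk H V1 V2 C ∧
    NX G X Y ⊆ V1 ∪ C ∪ V2 ∧
    (∃ y, IsEndOf G Y y ∧ ({v ∈ V1 | G.Adj y v} ⊆ C ∨ V1 ⊆ C ∪ {v | G.Adj y v})) ∧
    (∃ y, IsEndOf G Y y ∧ ({v ∈ V2 | G.Adj y v} ⊆ C ∨ V2 ⊆ C ∪ {v | G.Adj y v}))

def Podded (G : SimpleGraph V) (X : Set V) (H : Net V) (Y : Set V) : Prop :=
  ∃ C, IsPodOf G X H Y C

def Sticky (G : SimpleGraph V) (X : Set V) (H : Net V) (Y : Set V) : Prop :=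
  SolidOut G X H Y ∨ Podded G X H Y

/-- A triad of `ℍ`: `Δ(V1,V2,V3)` for three nodes inducing a triangle in `ℍ`. -/
def IsTriad (H : Net V) (T : Set V) : Prop :=
  ∃ V1 V2 V3, V1 ∈ H.nodes ∧ V2 ∈ H.nodes ∧ V3 ∈ H.nodes ∧
    H.AdjNodes V1 V2 ∧ H.AdjNodes V2 V3 ∧ H.AdjNodes V1 V3 ∧
    T = (V1 ∩ V2) ∪ (V2 ∩ V3) ∪ (V3 ∩ V1)

/-- A set `S ⊆ X` is `ℍ`-local: contained in a node, an arc, or a triad. -/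
def LocalSet (H : Net V) (S : Set V) : Prop :=
  (∃ N ∈ H.nodes, S ⊆ N) ∨ (∃ E ∈ H.arcs, S ⊆ E) ∨ ∃ T, IsTriad H T ∧ S ⊆ T

/-- `ℍ` is local: every connected `Y ⊆ V(G) ∖ X` is `ℍ`-local. -/
def LocalNet (G : SimpleGraph V) (X : Set V) (H : Net V) : Prop :=
  ∀ Y : Set V, Y ⊆ Xᶜ → (G.induce Y).Connected → LocalSet H (NX G X Y)

/-- `ℍ` has no parallel arcs. -/
def NoParallel (H : Net V) : Prop :=
  ∀ E ∈ H.arcs, ∀ F ∈ H.arcs, E ≠ F →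
    ({H.fst E, H.snd E} : Set (Set V)) ≠ {H.fst F, H.snd F}

/-- `ℓ(Y, ℍ, G)`: the minimum number of `ℍ`-tamed subsets of `X` whose union is
`N_G(Y, X)`. -/
noncomputable def ell (G : SimpleGraph V) (X : Set V) (H : Net V) (Y : Set V) : ℕ :=
  sInf {k | ∃ F : Finset (Set V), F.card = k ∧ (∀ S ∈ F, S ⊆ X ∧ Tamed H S) ∧
    ⋃₀ (↑F : Set (Set V)) = NX G X Y}


theorem aux_T {ν : Type*} [DecidableEq ν] {fs ft fx As At Ax : Finset ν} {a : ν}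
    (hs : fs.card = 2) (ht : ft.card = 2) (hx : fx.card = 2)
    (hAs : As ⊆ fs) (hAt : At ⊆ ft) (hAx : Ax ⊆ fx)
    (hne : fs ≠ ft) (has : a ∈ As) (hat : a ∈ At) (hax : a ∉ Ax)
    (h1 : fx = fs ∨ (Ax ∩ As).Nonempty) (h2 : fx = ft ∨ (Ax ∩ At).Nonempty) :
    ∃ b c, b ≠ a ∧ c ≠ a ∧ b ≠ c ∧ As = {a, b} ∧ At = {a, c} ∧ Ax = {b, c} ∧
      fs = {a, b} ∧ ft = {a, c} ∧ fx = {b, c} := by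
  have key : ∀ f : Finset ν, f.card = 2 → a ∈ f → ∃ b, b ≠ a ∧ f = {a, b} := by
    intro f hf ha
    obtain ⟨p, q, hpq, rfl⟩ := Finset.card_eq_two.1 hf
    simp only [Finset.mem_insert, Finset.mem_singleton] at ha
    rcases ha with rfl | rfl
    · exact ⟨q, hpq.symm, rfl⟩
    · exact ⟨p, hpq, Finset.pair_comm _ _⟩
  obtain ⟨b, hb, hfs⟩ := key fs hs (hAs has)
  obtain ⟨c, hc, hft⟩ := key ft ht (hAt hat)
  have hbc : b ≠ c := by rintro rfl; exact hne (hfs.trans hft.symm)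
  have m1 : ∀ y, y ∈ fs ↔ y = a ∨ y = b := by intro y; simp [hfs]
  have m2 : ∀ y, y ∈ ft ↔ y = a ∨ y = c := by intro y; simp [hft]
  have n1 : (Ax ∩ As).Nonempty → b ∈ Ax ∧ b ∈ As := by
    rintro ⟨y, hy⟩
    rw [Finset.mem_inter] at hy
    have := (m1 y).1 (hAs hy.2)
    grind
  have n2 : (Ax ∩ At).Nonempty → c ∈ Ax ∧ c ∈ At := by
    rintro ⟨y, hy⟩
    rw [Finset.mem_inter] at hy
    have := (m2 y).1 (hAt hy.2)
    grind
  have q1 : b ∈ Ax ∧ b ∈ As := by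
    rcases h1 with h | h
    · rcases h2 with h' | h'
      · exact absurd (h.symm.trans h') hne
      · have := hAx (n2 h').1
        rw [h, m1] at this
        grind
    · exact n1 h
  have q2 : c ∈ Ax ∧ c ∈ At := by
    rcases h2 with h | h
    · have := hAx q1.1
      rw [h, m2] at this
      grind
    · exact n2 h
  have e : ∀ {f A : Finset ν} {p q : ν}, f.card = 2 → A ⊆ f → p ≠ q → p ∈ A → q ∈ A →
      A = {p, q} ∧ f = {p, q} := by
    intro f A p q hf hA hpq hp hq
    have h1 : ({p, q} : Finset ν) ⊆ A := by
      intro y hy; simp at hy; rcases hy with rfl | rfl <;> assumption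
    have h2 : ({p, q} : Finset ν).card = 2 := Finset.card_pair hpq
    have h3 : ({p, q} : Finset ν) = f :=
      Finset.eq_of_subset_of_card_le (h1.trans hA) (by omega)
    exact ⟨Finset.Subset.antisymm (h3 ▸ hA) h1, h3.symm⟩
  have e1 := e hs hAs hb.symm has q1.2
  have e2 := e ht hAt hc.symm hat q2.2
  have e3 := e hx hAx hbc q1.1 q2.1
  exact ⟨b, c, hb, hc, hbc, e1.1, e2.1, e3.1, e1.2, e2.2, e3.2⟩

theorem aux_comb {α ν : Type*} [DecidableEq α] [DecidableEq ν] (f A : α → Finset ν)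
    (X S : Set α) (hSX : S ⊆ X) (hS0 : S.Nonempty)
    (hf : ∀ x ∈ X, (f x).card = 2) (hA : ∀ x ∈ X, A x ⊆ f x)
    (hS : ∀ u ∈ S, ∀ v ∈ S, f u = f v ∨ (A u ∩ A v).Nonempty) :
    ∃ R : Finset α, ↑R ⊆ S ∧ R.card ≤ 3 ∧
      ∀ x ∈ X, (∀ r ∈ R, f x = f r ∨ (A x ∩ A r).Nonempty) →
        ∀ s ∈ S, f x = f s ∨ (A x ∩ A s).Nonempty := by
  by_cases hone : ∀ u ∈ S, ∀ v ∈ S, f u = f v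
  · -- all in a single arc
    obtain ⟨s0, hs0⟩ := hS0
    obtain ⟨p, q, hpq, hfp⟩ := Finset.card_eq_two.1 (hf s0 (hSX hs0))
    have hfS : ∀ s ∈ S, f s = {p, q} := fun s hs => (hone s hs s0 hs0).trans hfp
    have hAS : ∀ s ∈ S, ∀ y ∈ A s, y = p ∨ y = q := by
      intro s hs y hy
      have := hA s (hSX hs) hy
      rw [hfS s hs] at this
      simpa using this
    have full : ∀ x ∈ X, p ∈ A x → q ∈ A x → f x = {p, q} := by
      intro x hx h1 h2
      have h3 : ({p, q} : Finset ν) ⊆ f x := by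
        intro y hy; simp at hy; rcases hy with rfl | rfl
        · exact hA x hx h1
        · exact hA x hx h2
      refine (Finset.eq_of_subset_of_card_le h3 ?_).symm
      rw [hf x hx, Finset.card_pair hpq]
    -- choose s without p, if any; t without q, if any
    have pick : ∀ z : ν, ∃ s ∈ S, (∃ s' ∈ S, z ∉ A s') → z ∉ A s := by
      intro z
      by_cases h : ∃ s' ∈ S, z ∉ A s'
      · obtain ⟨s', h1, h2⟩ := h
        exact ⟨s', h1, fun _ => h2⟩
      · exact ⟨s0, hs0, fun h' => absurd h' h⟩
    obtain ⟨s, hs, hs'⟩ := pick p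
    obtain ⟨t, ht, ht'⟩ := pick q
    refine ⟨{s, t}, ?_, (Finset.card_le_two).trans (by norm_num), ?_⟩
    · intro y hy
      simp at hy
      rcases hy with rfl | rfl <;> assumption
    · intro x hx hr v hv
      have h1 := hr s (by simp)
      have h2 := hr t (by simp)
      rw [hfS s hs] at h1
      rw [hfS t ht] at h2
      rw [hfS v hv]
      by_contra hcon
      rw [not_or] at hcon
      obtain ⟨c1, c2⟩ := hcon
      obtain ⟨y, hy⟩ := h1.resolve_left c1
      obtain ⟨z, hz⟩ := h2.resolve_left c1
      rw [Finset.mem_inter] at hy hz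
      have c3 : ∀ w, w ∈ A x → w ∉ A v := fun w h h' => c2 ⟨w, Finset.mem_inter.2 ⟨h, h'⟩⟩
      have d1 := hAS s hs y hy.2
      have d2 := hAS t ht z hz.2
      have d3 : ¬ (p ∈ A x ∧ q ∈ A x) := fun h => c1 (full x hx h.1 h.2)
      have d4 : p ∉ A v → p ∉ A s := fun h => hs' ⟨v, hv, h⟩
      have d5 : q ∉ A v → q ∉ A t := fun h => ht' ⟨v, hv, h⟩
      grind
  · push Not at hone
    obtain ⟨s, hs, t, ht, hst⟩ := hone
    obtain ⟨a, ha⟩ := (hS s hs t ht).resolve_left hst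
    rw [Finset.mem_inter] at ha
    obtain ⟨has, hat⟩ := ha
    have T : ∀ x ∈ X, a ∉ A x → (f x = f s ∨ (A x ∩ A s).Nonempty) →
        (f x = f t ∨ (A x ∩ A t).Nonempty) → ∃ b c, b ≠ a ∧ c ≠ a ∧ b ≠ c ∧
        A s = {a, b} ∧ A t = {a, c} ∧ A x = {b, c} ∧
        f s = {a, b} ∧ f t = {a, c} ∧ f x = {b, c} := fun x hx hax h1 h2 =>
      aux_T (hf s (hSX hs)) (hf t (hSX ht)) (hf x hx) (hA s (hSX hs)) (hA t (hSX ht))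
        (hA x hx) hst has hat hax h1 h2
    have T2 : ∀ x ∈ X, ∀ y ∈ X, a ∉ A x → a ∉ A y → (f x = f s ∨ (A x ∩ A s).Nonempty) →
        (f x = f t ∨ (A x ∩ A t).Nonempty) → (f y = f s ∨ (A y ∩ A s).Nonempty) →
        (f y = f t ∨ (A y ∩ A t).Nonempty) → A x = A y ∧ f x = f y := by
      intro x hx y hy hax hay h1 h2 h3 h4
      obtain ⟨b, c, hb, hc, hbc, e1, e2, e3, e4, e5, e6⟩ := T x hx hax h1 h2
      obtain ⟨b', c', hb', hc', hbc', e1', e2', e3', e4', e5', e6'⟩ := T y hy hay h3 h4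
      have hbb : b = b' := by
        have : b ∈ A s := by simp [e1]
        rw [e1'] at this; simp at this; tauto
      have hcc : c = c' := by
        have : c ∈ A t := by simp [e2]
        rw [e2'] at this; simp at this; tauto
      subst hbb hcc
      exact ⟨e3.trans e3'.symm, e6.trans e6'.symm⟩
    have build : ∀ u ∈ S, (↑({s, t, u} : Finset α) : Set α) ⊆ S := by
      intro u hu y hy
      simp at hy
      rcases hy with rfl | rfl | rfl <;> assumption
    by_cases hu : ∃ u ∈ S, a ∉ A u
    · obtain ⟨u, hu, hau⟩ := hu
      refine ⟨{s, t, u}, build u hu, Finset.card_le_three, ?_⟩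
      obtain ⟨b, c, hb, hc, hbc, e1, e2, e3, e4, e5, e6⟩ :=
        T u (hSX hu) hau (hS u hu s hs) (hS u hu t ht)
      have tri : ∀ x ∈ X, (f x = f s ∨ (A x ∩ A s).Nonempty) →
          (f x = f t ∨ (A x ∩ A t).Nonempty) → (f x = f u ∨ (A x ∩ A u).Nonempty) →
          (a ∈ A x ∧ b ∈ A x) ∨ (a ∈ A x ∧ c ∈ A x) ∨ (b ∈ A x ∧ c ∈ A x) := by
        intro x hx h1 h2 h3
        by_cases hax : a ∈ A x
        · have : f x ≠ f u := by
            intro h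
            have := hA x hx hax
            rw [h, e6] at this
            simp at this; tauto
          obtain ⟨y, hy⟩ := h3.resolve_left this
          rw [Finset.mem_inter, e3] at hy
          simp at hy
          grind
        · have := (T2 x hx u (hSX hu) hax hau h1 h2 (hS u hu s hs) (hS u hu t ht)).1
          right; right
          rw [this, e3]; simp
      intro x hx hr v hv
      have r1 := tri x hx (hr s (by simp)) (hr t (by simp)) (hr u (by simp))
      have r2 := tri v (hSX hv) (hS v hv s hs) (hS v hv t ht) (hS v hv u hu)
      right
      have : (a ∈ A x ∧ a ∈ A v) ∨ (b ∈ A x ∧ b ∈ A v) ∨ (c ∈ A x ∧ c ∈ A v) := by tauto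
      rcases this with h | h | h
      · exact ⟨a, Finset.mem_inter.2 h⟩
      · exact ⟨b, Finset.mem_inter.2 h⟩
      · exact ⟨c, Finset.mem_inter.2 h⟩
    · push Not at hu
      have noa : ∀ x, ∀ v ∈ S, ¬ (f x = f v ∨ (A x ∩ A v).Nonempty) → a ∉ A x :=
        fun x v hv h hax => h (Or.inr ⟨a, Finset.mem_inter.2 ⟨hax, hu v hv⟩⟩)
      by_cases hx : ∃ x ∈ X, (f x = f s ∨ (A x ∩ A s).Nonempty) ∧
          (f x = f t ∨ (A x ∩ A t).Nonempty) ∧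
          ∃ u ∈ S, ¬ (f x = f u ∨ (A x ∩ A u).Nonempty)
      · obtain ⟨x, hx, h1, h2, u, huS, h3⟩ := hx
        refine ⟨{s, t, u}, build u huS, Finset.card_le_three, ?_⟩
        intro y hy hr v hv
        by_contra hcon
        have := T2 x hx y hy (noa x u huS h3) (noa y v hv hcon) h1 h2
          (hr s (by simp)) (hr t (by simp))
        apply h3
        rw [this.1, this.2]
        exact hr u (by simp)
      · refine ⟨{s, t, s}, build s hs, Finset.card_le_three, ?_⟩
        intro y hy hr v hv
        by_contra hcon
        exact hx ⟨y, hy, hr s (by simp), hr t (by simp), v, hv, hcon⟩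

/-- In an `X`-net with no parallel arcs, every nonempty
`S ⊆ X` admits a representative set `R ⊆ S` with `|R| ≤ 3` such that for every
`W ⊆ X`, `R ∪ W` is `ℍ`-tamed iff `S ∪ W` is `ℍ`-tamed. -/
theorem representative_set_exists
    {V : Type*} [Fintype V] (G : SimpleGraph V)
    (hconn : G.Connected) (hleaves : {v | IsLeaf G v}.ncard = 3)
    (X : Set V) (H : Net V) (hnet : IsNet G X H) (hpar : NoParallel H) :
    ∀ S : Set V, S ⊆ X → S.Nonempty →
      ∃ R, R ⊆ S ∧ R.ncard ≤ 3 ∧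
        ∀ W : Set V, W ⊆ X → (Tamed H (R ∪ W) ↔ Tamed H (S ∪ W)) := by
  intro S hSX hS0
  have hE : ∀ x ∈ X, ∃ E ∈ H.arcs, x ∈ E := by
    intro x hx
    rw [← hnet.arcs_cover] at hx
    exact hx
  choose! e he hxe using hE
  have huniq : ∀ x ∈ X, ∀ E ∈ H.arcs, x ∈ E → E = e x := by
    intro x hx E hEa hxE
    by_contra hne
    have h0 := hnet.arcs_disjoint E hEa (e x) (he x hx) hne
    have : x ∈ E ∩ e x := ⟨hxE, hxe x hx⟩
    rw [h0] at this
    exact this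
  let f : V → Finset (Set V) := fun x => {H.fst (e x), H.snd (e x)}
  let A : V → Finset (Set V) := fun x => (f x).filter (fun N => x ∈ N)
  have hf : ∀ x ∈ X, (f x).card = 2 := fun x hx =>
    Finset.card_pair (hnet.ends_ne _ (he x hx))
  have hA : ∀ x ∈ X, A x ⊆ f x := fun x _ => Finset.filter_subset _ _
  have hmemA : ∀ x ∈ X, ∀ N, N ∈ A x ↔ N ∈ H.nodes ∧ x ∈ N := by
    intro x hx N
    have hN : N ∈ f x ↔ N = H.fst (e x) ∨ N = H.snd (e x) := by simp [f]
    rw [Finset.mem_filter, hN]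
    constructor
    · rintro ⟨h1, h2⟩
      refine ⟨?_, h2⟩
      rcases h1 with rfl | rfl
      · exact hnet.fst_mem _ (he x hx)
      · exact hnet.snd_mem _ (he x hx)
    · rintro ⟨h1, h2⟩
      refine ⟨?_, h2⟩
      have := (hnet.meets_iff (e x) (he x hx) N h1).1 ⟨x, hxe x hx, h2⟩
      rcases this with h | h
      · exact Or.inl h.symm
      · exact Or.inr h.symm
  have hrel : ∀ u ∈ X, ∀ v ∈ X,
      (((∃ E ∈ H.arcs, u ∈ E ∧ v ∈ E) ∨ (∃ N ∈ H.nodes, u ∈ N ∧ v ∈ N)) ↔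
        (f u = f v ∨ (A u ∩ A v).Nonempty)) := by
    intro u hu v hv
    apply or_congr
    · constructor
      · rintro ⟨E, hEa, h1, h2⟩
        have := (huniq u hu E hEa h1).symm.trans (huniq v hv E hEa h2)
        simp only [f, this]
      · intro h
        have : e u = e v := by
          by_contra hne
          apply hpar _ (he u hu) _ (he v hv) hne
          have := congrArg (fun s : Finset (Set V) => (s : Set (Set V))) h
          simpa [f] using this
        exact ⟨e u, he u hu, hxe u hu, this ▸ hxe v hv⟩
    · constructor
      · rintro ⟨N, hN, h1, h2⟩
        exact ⟨N, Finset.mem_inter.2 ⟨(hmemA u hu N).2 ⟨hN, h1⟩, (hmemA v hv N).2 ⟨hN, h2⟩⟩⟩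
      · rintro ⟨N, hN⟩
        rw [Finset.mem_inter, hmemA u hu, hmemA v hv] at hN
        exact ⟨N, hN.1.1, hN.1.2, hN.2.2⟩
  have mono : ∀ P Q : Set V, P ⊆ Q → Tamed H Q → Tamed H P :=
    fun P Q h hT u hu v hv => hT u (h hu) v (h hv)
  have symm : ∀ u v : V, ((∃ E ∈ H.arcs, u ∈ E ∧ v ∈ E) ∨ (∃ N ∈ H.nodes, u ∈ N ∧ v ∈ N)) →
      ((∃ E ∈ H.arcs, v ∈ E ∧ u ∈ E) ∨ (∃ N ∈ H.nodes, v ∈ N ∧ u ∈ N)) := by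
    rintro u v (⟨E, h1, h2, h3⟩ | ⟨E, h1, h2, h3⟩)
    · exact Or.inl ⟨E, h1, h3, h2⟩
    · exact Or.inr ⟨E, h1, h3, h2⟩
  by_cases hT : Tamed H S
  · obtain ⟨R, hRS, hRc, hR⟩ := aux_comb f A X S hSX hS0 hf hA
      (fun u hu v hv => (hrel u (hSX hu) v (hSX hv)).1 (hT u hu v hv))
    refine ⟨↑R, hRS, by rwa [Set.ncard_coe_finset], ?_⟩
    intro W hW
    refine ⟨fun h => ?_, mono _ _ (Set.union_subset_union_left W hRS)⟩
    have cross : ∀ w ∈ W, ∀ s ∈ S,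
        ((∃ E ∈ H.arcs, w ∈ E ∧ s ∈ E) ∨ (∃ N ∈ H.nodes, w ∈ N ∧ s ∈ N)) := by
      intro w hw s hs
      refine (hrel w (hW hw) s (hSX hs)).2 (hR w (hW hw) (fun r hr => ?_) s hs)
      exact (hrel w (hW hw) r (hSX (hRS hr))).1 (h w (Or.inr hw) r (Or.inl hr))
    rintro u (hu | hu) v (hv | hv)
    · exact hT u hu v hv
    · exact symm _ _ (cross v hv u hu)
    · exact cross u hu v hv
    · exact h u (Or.inr hu) v (Or.inr hv)
  · have hT' := hT
    unfold Tamed at hT'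
    push Not at hT'
    obtain ⟨u, hu, v, hv, h1, h2⟩ := hT'
    have hRS : ({u, v} : Set V) ⊆ S := by
      rintro y (rfl | rfl) <;> assumption
    refine ⟨{u, v}, hRS, (Set.ncard_insert_le u {v}).trans (by rw [Set.ncard_singleton]; norm_num), ?_⟩
    intro W _
    refine ⟨fun h => ?_, mono _ _ (Set.union_subset_union_left W hRS)⟩
    exfalso
    rcases h u (Or.inl (by simp)) v (Or.inl (by simp)) with ⟨E, a1, a2, a3⟩ | ⟨E, a1, a2, a3⟩
    · exact h1 E a1 a2 a3
    · exact h2 E a1 a2 a3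

end ThreeInATree
end

section
/- Let G be a finite simple graph. Then G contains a pyramid if and only if there exist distinct vertices b1, b2, b3 of G such that G[{b1,b2,b3}] is a triangle and the graph G(b1,b2,b3) contains an induced subgraph that is a tree containing all of b1, b2, b3, where G(b1,b2,b3) is obtained from G by (1) for each i ∈ {1,2,3}, adding edges so that N(b_i)∖{b1,b2,b3} becomes a clique, (2) deleting the edges b1b2, b2b3, b3b1, and (3) deleting all vertices of (N(b_i)∩N(b_j))∖{b1,b2,b3} for every pair of distinct indices i, j in {1,2,3}. -/
namespace Detect

variable {V : Type*}

/-- `v` is a leaf of the induced subgraph `G[T]`: it lies in `T` and has exactly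
one neighbor inside `T`. -/
def LeafIn (G : SimpleGraph V) (T : Set V) (v : V) : Prop :=
  v ∈ T ∧ ∃! w, w ∈ T ∧ G.Adj v w

/-- `G` contains a pyramid: a triangle `b1b2b3` and a set `T` inducing, in the
graph `G` minus the three triangle edges, a tree with exactly three leaves
`b1, b2, b3`, such that `G[{b1,b2,b3}]` is the only triangle of `G[T]`. -/
def ContainsPyramid (G : SimpleGraph V) : Prop :=
  ∃ (b1 b2 b3 : V) (T : Set V),
    G.Adj b1 b2 ∧ G.Adj b2 b3 ∧ G.Adj b1 b3 ∧
    b1 ≠ b2 ∧ b2 ≠ b3 ∧ b1 ≠ b3 ∧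
    ((G.deleteEdges {s(b1, b2), s(b2, b3), s(b1, b3)}).induce T).IsTree ∧
    {v | LeafIn (G.deleteEdges {s(b1, b2), s(b2, b3), s(b1, b3)}) T v} = {b1, b2, b3} ∧
    (∀ x ∈ T, ∀ y ∈ T, ∀ z ∈ T, G.Adj x y → G.Adj y z → G.Adj x z →
      ({x, y, z} : Set V) = {b1, b2, b3})

/-- The auxiliary graph `G(b1, b2, b3)`: (1) add edges making each
`N(bᵢ) ∖ {b1,b2,b3}` a clique, (2) delete the edges `b1b2, b2b3, b3b1`, and
(3) delete the vertices of `(N(bᵢ) ∩ N(bⱼ)) ∖ {b1,b2,b3}` for all `i ≠ j`. -/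
def pyramidAux (G : SimpleGraph V) (b1 b2 b3 : V) : SimpleGraph V :=
  SimpleGraph.fromRel (fun x y =>
    (∀ c ∈ ({b1, b2, b3} : Set V), ∀ c' ∈ ({b1, b2, b3} : Set V), c ≠ c' →
        x ∉ (G.neighborSet c ∩ G.neighborSet c') \ {b1, b2, b3} ∧
        y ∉ (G.neighborSet c ∩ G.neighborSet c') \ {b1, b2, b3}) ∧
    ¬ (({x, y} : Set V) = {b1, b2} ∨ ({x, y} : Set V) = {b2, b3} ∨
        ({x, y} : Set V) = {b1, b3}) ∧
    (G.Adj x y ∨ ∃ c ∈ ({b1, b2, b3} : Set V),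
        x ∈ G.neighborSet c \ {b1, b2, b3} ∧ y ∈ G.neighborSet c \ {b1, b2, b3}))

theorem aux_adj (G : SimpleGraph V) (b1 b2 b3 x y : V) (h12 : b1 ≠ b2) (h23 : b2 ≠ b3)
    (h13 : b1 ≠ b3) (B R : V → Prop)
    (hB : ∀ x, B x ↔ (x = b1 ∨ x = b2 ∨ x = b3))
    (hR : ∀ x, R x ↔ (¬ B x ∧ ∃ c c', B c ∧ B c' ∧ c ≠ c' ∧ G.Adj c x ∧ G.Adj c' x)) :
    (pyramidAux G b1 b2 b3).Adj x y ↔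
      x ≠ y ∧ ¬ R x ∧ ¬ R y ∧ ¬ (B x ∧ B y) ∧
        (G.Adj x y ∨ ∃ c, B c ∧ ¬ B x ∧ ¬ B y ∧ G.Adj c x ∧ G.Adj c y) := by
  have key : ∀ x y, x ≠ y → ((({x, y} : Set V) = {b1, b2} ∨ ({x, y} : Set V) = {b2, b3} ∨
        ({x, y} : Set V) = {b1, b3}) ↔ (B x ∧ B y)) := by
    intro x y hxy
    simp only [Set.pair_eq_pair_iff, hB]
    grind
  have hrem : ∀ x y, (∀ c ∈ ({b1, b2, b3} : Set V), ∀ c' ∈ ({b1, b2, b3} : Set V), c ≠ c' →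
        x ∉ (G.neighborSet c ∩ G.neighborSet c') \ {b1, b2, b3} ∧
        y ∉ (G.neighborSet c ∩ G.neighborSet c') \ {b1, b2, b3}) ↔ ¬ R x ∧ ¬ R y := by
    intro x y
    have e : ∀ z, z ∈ ({b1, b2, b3} : Set V) ↔ B z := by intro z; rw [hB]; simp
    simp only [hR, Set.mem_sdiff, Set.mem_inter_iff, SimpleGraph.mem_neighborSet, e]
    grind
  have hadd : ∀ x y, (∃ c ∈ ({b1, b2, b3} : Set V),
        x ∈ G.neighborSet c \ {b1, b2, b3} ∧ y ∈ G.neighborSet c \ {b1, b2, b3}) ↔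
        ∃ c, B c ∧ ¬ B x ∧ ¬ B y ∧ G.Adj c x ∧ G.Adj c y := by
    intro x y
    have e : ∀ z, z ∈ ({b1, b2, b3} : Set V) ↔ B z := by intro z; rw [hB]; simp
    simp only [Set.mem_sdiff, SimpleGraph.mem_neighborSet, e]
    grind
  unfold pyramidAux
  simp only [SimpleGraph.fromRel_adj, hrem, hadd]
  by_cases hxy : x = y
  · simp [hxy]
  · rw [key x y hxy, key y x (Ne.symm hxy), G.adj_comm y x]
    grind

theorem del_adj (G : SimpleGraph V) (b1 b2 b3 x y : V) (h12 : b1 ≠ b2) (h23 : b2 ≠ b3)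
    (h13 : b1 ≠ b3) (B : V → Prop)
    (hB : ∀ x, B x ↔ (x = b1 ∨ x = b2 ∨ x = b3)) :
    (G.deleteEdges {s(b1, b2), s(b2, b3), s(b1, b3)}).Adj x y ↔
      G.Adj x y ∧ ¬ (B x ∧ B y) := by
  simp only [SimpleGraph.deleteEdges_adj, Set.mem_insert_iff, Set.mem_singleton_iff, Sym2.eq_iff,
    hB]
  have := G.ne_of_adj (a := x) (b := y)
  grind

theorem induce_congr {A A' : SimpleGraph V} {T : Set V}
    (h : ∀ x ∈ T, ∀ y ∈ T, A.Adj x y ↔ A'.Adj x y) : A.induce T = A'.induce T := by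
  ext x y
  simpa using h x x.2 y y.2

theorem no_tri {A : SimpleGraph V} {T : Set V} (h : (A.induce T).IsAcyclic) {x y z : V}
    (hx : x ∈ T) (hy : y ∈ T) (hz : z ∈ T) (hxy : A.Adj x y) (hyz : A.Adj y z)
    (hxz : A.Adj x z) : False := by
  obtain ⟨c⟩ := h.colorable_two
  have h1 : c ⟨x, hx⟩ ≠ c ⟨y, hy⟩ := c.valid (by simpa using hxy)
  have h2 : c ⟨y, hy⟩ ≠ c ⟨z, hz⟩ := c.valid (by simpa using hyz)
  have h3 : c ⟨x, hx⟩ ≠ c ⟨z, hz⟩ := c.valid (by simpa using hxz)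
  omega

theorem exists_nbr {A : SimpleGraph V} {T : Set V} (h : (A.induce T).IsTree) {x a b : V}
    (hx : x ∈ T) (ha : a ∈ T) (hb : b ∈ T) (hab : a ≠ b) : ∃ y ∈ T, A.Adj x y := by
  haveI : Nontrivial T := ⟨⟨a, ha⟩, ⟨b, hb⟩, by simpa using hab⟩
  obtain ⟨u, hu⟩ := h.connected.preconnected.exists_adj_of_nontrivial ⟨x, hx⟩
  exact ⟨u, u.2, by simpa using hu⟩

theorem remove_leaf [Finite V] {A : SimpleGraph V} {T : Set V} (h : (A.induce T).IsTree) {v : V}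
    (hv : LeafIn A T v) : (A.induce (T \ {v})).IsTree := by
  classical
  haveI := Fintype.ofFinite V
  obtain ⟨hvT, w, ⟨hwT, hw⟩, hu⟩ := hv
  have hdeg : (A.induce T).degree ⟨v, hvT⟩ = 1 := by
    rw [SimpleGraph.degree_eq_one_iff_existsUnique_adj]
    refine ⟨⟨w, hwT⟩, by simpa using hw, ?_⟩
    rintro ⟨y, hy⟩ hvy
    exact Subtype.ext (hu y ⟨hy, by simpa using hvy⟩)
  have hc := h.connected.induce_compl_singleton_of_degree_eq_one hdeg
  refine ⟨?_, ?_⟩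
  · refine hc.map (H := A.induce (T \ {v})) ⟨fun x => ⟨x.1.1, x.1.2, ?_⟩, ?_⟩ ?_
    · intro hx
      exact x.2 (Subtype.ext hx)
    · intro a b hab
      simpa using hab
    · rintro ⟨x, hx, hxv⟩
      exact ⟨⟨⟨x, hx⟩, fun hh => hxv (congrArg Subtype.val hh)⟩, rfl⟩
  · refine h.isAcyclic.comap (G := A.induce (T \ {v})) ⟨fun x => ⟨x.1, x.2.1⟩, ?_⟩ ?_
    · intro a b hab
      simpa using hab
    · intro a b hab
      have h2 : a.1 = b.1 := Subtype.mk.inj hab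
      exact Subtype.ext h2

theorem exists_min [Finite V] (A : SimpleGraph V) (b1 b2 b3 : V) (T : Set V)
    (h1 : b1 ∈ T) (h2 : b2 ∈ T) (h3 : b3 ∈ T) (h : (A.induce T).IsTree) :
    ∃ T : Set V, b1 ∈ T ∧ b2 ∈ T ∧ b3 ∈ T ∧ (A.induce T).IsTree ∧
      ∀ v, LeafIn A T v → v = b1 ∨ v = b2 ∨ v = b3 := by
  obtain ⟨S, -, hS⟩ := (Set.toFinite {T : Set V | b1 ∈ T ∧ b2 ∈ T ∧ b3 ∈ T ∧
    (A.induce T).IsTree}).exists_le_minimal (a := T) ⟨h1, h2, h3, h⟩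
  obtain ⟨⟨g1, g2, g3, g⟩, hmin⟩ := hS
  refine ⟨S, g1, g2, g3, g, ?_⟩
  intro v hv
  by_contra hne
  push Not at hne
  have := hmin (y := S \ {v}) ⟨⟨g1, fun e => hne.1 e.symm⟩, ⟨g2, fun e => hne.2.1 e.symm⟩,
    ⟨g3, fun e => hne.2.2 e.symm⟩, remove_leaf g hv⟩ Set.sdiff_subset
  exact (this hv.1).2 rfl

/-- `G` contains a pyramid iff for some triangle `b1b2b3` of
`G`, the graph `G(b1,b2,b3)` has an induced tree containing `b1, b2, b3`. -/
theorem containsPyramid_iff_three_in_a_tree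
    {V : Type*} [Fintype V] (G : SimpleGraph V) :
    ContainsPyramid G ↔
      ∃ b1 b2 b3 : V,
        b1 ≠ b2 ∧ b2 ≠ b3 ∧ b1 ≠ b3 ∧
        G.Adj b1 b2 ∧ G.Adj b2 b3 ∧ G.Adj b1 b3 ∧
        ∃ T : Set V, b1 ∈ T ∧ b2 ∈ T ∧ b3 ∈ T ∧
          ((pyramidAux G b1 b2 b3).induce T).IsTree := by
  constructor
  · rintro ⟨b1, b2, b3, T, a12, a23, a13, h12, h23, h13, htree, hleaf, htri⟩
    refine ⟨b1, b2, b3, h12, h23, h13, a12, a23, a13, T, ?_⟩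
    obtain ⟨B, hB⟩ : ∃ B : V → Prop, ∀ x, B x ↔ (x = b1 ∨ x = b2 ∨ x = b3) := ⟨_, fun _ => Iff.rfl⟩
    obtain ⟨R, hR⟩ : ∃ R : V → Prop, ∀ x, R x ↔
      (¬ B x ∧ ∃ c c', B c ∧ B c' ∧ c ≠ c' ∧ G.Adj c x ∧ G.Adj c' x) := ⟨_, fun _ => Iff.rfl⟩
    have hP := fun x y => aux_adj G b1 b2 b3 x y h12 h23 h13 B R hB hR
    have hD := fun x y => del_adj G b1 b2 b3 x y h12 h23 h13 B hB
    have hL : ∀ c, B c → LeafIn (G.deleteEdges {s(b1, b2), s(b2, b3), s(b1, b3)}) T c := by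
      intro c hc
      have : c ∈ ({b1, b2, b3} : Set V) := by simpa using (hB c).1 hc
      rw [← hleaf] at this
      exact this
    have hBT : ∀ c, B c → c ∈ T := fun c hc => (hL c hc).1
    have hBB : ∀ c c', B c → B c' → c ≠ c' → G.Adj c c' := by
      intro c c' hc hc' hne
      rw [hB] at hc hc'
      have := a12.symm
      have := a23.symm
      have := a13.symm
      grind
    have hnR : ∀ x ∈ T, ¬ R x := by
      intro x hx hr
      obtain ⟨hnb, c, c', hc, hc', hne, e, e'⟩ := (hR x).1 hr
      have := htri c (hBT c hc) c' (hBT c' hc') x hx (hBB c c' hc hc' hne) e' e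
      apply hnb
      have hx : x ∈ ({c, c', x} : Set V) := by simp
      rw [this] at hx
      rw [hB]
      simpa using hx
    refine ⟨hBT _ (by simp [hB]), hBT _ (by simp [hB]), hBT _ (by simp [hB]), ?_⟩
    rw [induce_congr (A' := G.deleteEdges {s(b1, b2), s(b2, b3), s(b1, b3)})]
    · exact htree
    · intro x hx y hy
      rw [hP, hD]
      constructor
      · rintro ⟨hne, _, _, hb, h | ⟨c, hc, hxb, hyb, e, e'⟩⟩
        · exact ⟨h, hb⟩
        · exfalso
          obtain ⟨_, w, _, hu⟩ := hL c hc
          exact hne ((hu x ⟨hx, (hD c x).2 ⟨e, fun h => hxb h.2⟩⟩).trans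
            (hu y ⟨hy, (hD c y).2 ⟨e', fun h => hyb h.2⟩⟩).symm)
      · rintro ⟨h, hb⟩
        exact ⟨h.ne, hnR x hx, hnR y hy, hb, Or.inl h⟩
  · rintro ⟨b1, b2, b3, h12, h23, h13, a12, a23, a13, T0, m1, m2, m3, ht0⟩
    obtain ⟨T, t1, t2, t3, ht, hmin⟩ := exists_min _ b1 b2 b3 T0 m1 m2 m3 ht0
    obtain ⟨B, hB⟩ : ∃ B : V → Prop, ∀ x, B x ↔ (x = b1 ∨ x = b2 ∨ x = b3) := ⟨_, fun _ => Iff.rfl⟩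
    obtain ⟨R, hR⟩ : ∃ R : V → Prop, ∀ x, R x ↔
      (¬ B x ∧ ∃ c c', B c ∧ B c' ∧ c ≠ c' ∧ G.Adj c x ∧ G.Adj c' x) := ⟨_, fun _ => Iff.rfl⟩
    have hP := fun x y => aux_adj G b1 b2 b3 x y h12 h23 h13 B R hB hR
    have hD := fun x y => del_adj G b1 b2 b3 x y h12 h23 h13 B hB
    have hBT : ∀ c, B c → c ∈ T := by
      intro c hc
      rcases (hB c).1 hc with rfl | rfl | rfl <;> assumption
    have hnbr : ∀ x ∈ T, ∃ y ∈ T, (pyramidAux G b1 b2 b3).Adj x y :=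
      fun x hx => exists_nbr ht hx t1 t2 h12
    have hnR : ∀ x ∈ T, ¬ R x := by
      intro x hx
      obtain ⟨y, hy, h⟩ := hnbr x hx
      exact ((hP x y).1 h).2.1
    have hnRB : ∀ c, B c → ¬ R c := fun c hc hr => ((hR c).1 hr).1 hc
    have huniq : ∀ c, B c → ∀ x ∈ T, ∀ y ∈ T, ¬ B x → ¬ B y → G.Adj c x → G.Adj c y → x = y := by
      intro c hc x hx y hy hxb hyb e e'
      by_contra hne
      refine no_tri ht.isAcyclic (hBT c hc) hx hy ?_ ?_ ?_ (A := pyramidAux G b1 b2 b3)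
      · exact (hP c x).2 ⟨e.ne, hnRB c hc, hnR x hx, fun h => hxb h.2, Or.inl e⟩
      · exact (hP x y).2 ⟨hne, hnR x hx, hnR y hy, fun h => hyb h.2,
          Or.inr ⟨c, hc, hxb, hyb, e, e'⟩⟩
      · exact (hP c y).2 ⟨e'.ne, hnRB c hc, hnR y hy, fun h => hyb h.2, Or.inl e'⟩
    have hPD : ∀ x ∈ T, ∀ y ∈ T, (pyramidAux G b1 b2 b3).Adj x y ↔
        (G.deleteEdges {s(b1, b2), s(b2, b3), s(b1, b3)}).Adj x y := by
      intro x hx y hy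
      rw [hP, hD]
      constructor
      · rintro ⟨hne, _, _, hb, h | ⟨c, hc, hxb, hyb, e, e'⟩⟩
        · exact ⟨h, hb⟩
        · exact absurd (huniq c hc x hx y hy hxb hyb e e') hne
      · rintro ⟨h, hb⟩
        exact ⟨h.ne, hnR x hx, hnR y hy, hb, Or.inl h⟩
    have hT := ht
    rw [induce_congr hPD] at hT
    refine ⟨b1, b2, b3, T, a12, a23, a13, h12, h23, h13, hT, ?_, ?_⟩
    · ext v
      have e : v ∈ ({b1, b2, b3} : Set V) ↔ B v := by rw [hB]; simp
      rw [e]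
      constructor
      · rintro ⟨hv, w, ⟨hw, hvw⟩, hu⟩
        rw [hB]
        apply hmin
        exact ⟨hv, w, ⟨hw, (hPD v hv w hw).2 hvw⟩, fun y hy =>
          hu y ⟨hy.1, (hPD v hv y hy.1).1 hy.2⟩⟩
      · intro hv
        obtain ⟨y, hy, h⟩ := hnbr v (hBT v hv)
        have h' := (hPD v (hBT v hv) y hy).1 h
        refine ⟨hBT v hv, y, ⟨hy, h'⟩, ?_⟩
        rintro z ⟨hz, hvz⟩
        rw [hD] at h' hvz
        exact huniq v hv z hz y hy (fun h => hvz.2 ⟨hv, h⟩) (fun h => h'.2 ⟨hv, h⟩) hvz.1 h'.1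
    · intro x hx y hy z hz hxy hyz hxz
      have third : ∀ p ∈ T, ∀ q r, B q → B r → q ≠ r → G.Adj q p → G.Adj r p → B p := by
        intro p hp q r hq hr hne e e'
        by_contra hb
        exact hnR p hp ((hR p).2 ⟨hb, q, r, hq, hr, hne, e, e'⟩)
      have hall : B x ∧ B y ∧ B z := by
        by_contra hcon
        have n1 : ¬ (B x ∧ B y) := fun h =>
          hcon ⟨h.1, h.2, third z hz x y h.1 h.2 hxy.ne hxz hyz⟩
        have n2 : ¬ (B y ∧ B z) := fun h =>
          hcon ⟨third x hx y z h.1 h.2 hyz.ne hxy.symm hxz.symm, h.1, h.2⟩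
        have n3 : ¬ (B x ∧ B z) := fun h =>
          hcon ⟨h.1, third y hy x z h.1 h.2 hxz.ne hxy hyz.symm, h.2⟩
        exact no_tri hT.isAcyclic hx hy hz ((hD x y).2 ⟨hxy, n1⟩) ((hD y z).2 ⟨hyz, n2⟩)
          ((hD x z).2 ⟨hxz, n3⟩)
      obtain ⟨hbx, hby, hbz⟩ := hall
      rw [hB] at hbx hby hbz
      have := hxy.ne
      have := hyz.ne
      have := hxz.ne
      ext v
      simp only [Set.mem_insert_iff, Set.mem_singleton_iff]
      grind

end Detect
end

section
/- Let G be a finite simple 4-hole-free graph and let C be a shortest even hole of G. Then at least one of the following holds: (1) there exist a vertex v of C with neighbors v1 and v2 on C such that C is a v1v2-hole of the graph G−(N(v)∖{v1,v2}); (2) there exists a maximal clique K of G with V(K)∩V(C) = ∅ such that for every path of C with exactly 3 vertices and end-vertices v1 and v2, C is a v1v2-hole of the graph G−V(K). -/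
namespace OddEven

variable {V : Type*}

/-- `C` is a hole of `G`: a vertex set inducing a cycle (connected, every vertex
having exactly two neighbors inside) with at least 4 vertices. -/
def IsHole (G : SimpleGraph V) (C : Set V) : Prop :=
  (G.induce C).Connected ∧ (∀ v ∈ C, {w ∈ C | G.Adj v w}.ncard = 2) ∧ 4 ≤ C.ncard

def IsEvenHole (G : SimpleGraph V) (C : Set V) : Prop :=
  IsHole G C ∧ Even C.ncard

/-- A shortest even hole of `G`. -/
def IsShortestEvenHole (G : SimpleGraph V) (C : Set V) : Prop :=
  IsEvenHole G C ∧ ∀ C', IsEvenHole G C' → C.ncard ≤ C'.ncard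

/-- A major vertex of the even hole `C` in `H`: a vertex outside `C` with at
least three pairwise nonadjacent neighbors on `C`. -/
def IsMajor (H : SimpleGraph V) (C : Set V) (v : V) : Prop :=
  v ∉ C ∧ ∃ a b c, a ∈ C ∧ b ∈ C ∧ c ∈ C ∧
    H.Adj v a ∧ H.Adj v b ∧ H.Adj v c ∧
    a ≠ b ∧ b ≠ c ∧ a ≠ c ∧ ¬ H.Adj a b ∧ ¬ H.Adj b c ∧ ¬ H.Adj a c

/-- The hole `C` is clear in `H`: it has no major vertex. -/
def IsClear (H : SimpleGraph V) (C : Set V) : Prop := ∀ v, ¬ IsMajor H C v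

/-- A `v1v2`-hole of `H`: a clear shortest even hole of `H` in which `v1` and
`v2` are the end-vertices of a path of `C` with exactly 3 vertices. -/
def IsVVHole (H : SimpleGraph V) (v1 v2 : V) (C : Set V) : Prop :=
  IsShortestEvenHole H C ∧ IsClear H C ∧
    v1 ∈ C ∧ v2 ∈ C ∧ v1 ≠ v2 ∧
    ∃ u ∈ C, u ≠ v1 ∧ u ≠ v2 ∧ H.Adj v1 u ∧ H.Adj u v2

/-- The graph `G − S`, modeled on the same vertex type: all edges meeting `S`
are removed (so the vertices of `S` become irrelevant isolated vertices). -/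
def delVerts (G : SimpleGraph V) (S : Set V) : SimpleGraph V :=
  SimpleGraph.fromRel (fun x y => x ∉ S ∧ y ∉ S ∧ G.Adj x y)

/-! ### Abstract combinatorics on periodic predicates over the integers -/

def Maj (n : ℤ) (X : ℤ → Prop) : Prop :=
  ∀ s, ∃ a b c, s ≤ a ∧ a + 2 ≤ b ∧ b + 2 ≤ c ∧ c < s + n ∧ c + 2 ≤ a + n ∧ X a ∧ X b ∧ X c

def Gap (X : ℤ → Prop) : Prop :=
  ∀ i j, i < j → X i → X j → (∀ k, i < k → k < j → ¬ X k) → (j - i) % 2 = 1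

def SegD (X Z : ℤ → Prop) (i j : ℤ) : Prop :=
  i ≤ j ∧ X i ∧ Z j ∧ (∀ k, i < k → k ≤ j → ¬ X k) ∧ (∀ k, i ≤ k → k < j → ¬ Z k)

def Seg (X Z : ℤ → Prop) (i j : ℤ) : Prop := SegD X Z i j ∨ SegD Z X i j

theorem SegD.shift {X Z : ℤ → Prop} {K i j : ℤ}
    (h : SegD (fun i => X (K + i)) (fun i => Z (K + i)) i j) : SegD X Z (K + i) (K + j) := by
  obtain ⟨h1, h2, h3, h4, h5⟩ := h
  refine ⟨by omega, h2, h3, fun k a b => ?_, fun k a b => ?_⟩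
  · have := h4 (k - K) (by omega) (by omega)
    simpa using this
  · have := h5 (k - K) (by omega) (by omega)
    simpa using this

theorem SegD.neg {X Z : ℤ → Prop} {K i j : ℤ}
    (h : SegD (fun i => X (K - i)) (fun i => Z (K - i)) i j) : SegD Z X (K - j) (K - i) := by
  obtain ⟨h1, h2, h3, h4, h5⟩ := h
  refine ⟨by omega, h3, h2, fun k a b => ?_, fun k a b => ?_⟩
  · have := h5 (K - k) (by omega) (by omega)
    simpa using this
  · have := h4 (K - k) (by omega) (by omega)
    simpa using this

theorem Seg.shift {X Z : ℤ → Prop} {K i j : ℤ}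
    (h : Seg (fun i => X (K + i)) (fun i => Z (K + i)) i j) : Seg X Z (K + i) (K + j) :=
  h.imp SegD.shift SegD.shift

theorem Seg.neg {X Z : ℤ → Prop} {K i j : ℤ}
    (h : Seg (fun i => X (K - i)) (fun i => Z (K - i)) i j) : Seg X Z (K - j) (K - i) :=
  h.symm.imp SegD.neg SegD.neg

theorem Seg.swap {X Z : ℤ → Prop} {i j : ℤ} (h : Seg X Z i j) : Seg Z X i j := h.symm

theorem Maj.shift {n : ℤ} {X : ℤ → Prop} (h : Maj n X) (K : ℤ) : Maj n (fun i => X (K + i)) := by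
  intro s
  obtain ⟨a, b, c, h1, h2, h3, h4, h5, h6, h7, h8⟩ := h (K + s)
  refine ⟨a - K, b - K, c - K, by omega, by omega, by omega, by omega, by omega, ?_, ?_, ?_⟩ <;>
    simpa

theorem Maj.neg {n : ℤ} {X : ℤ → Prop} (h : Maj n X) (K : ℤ) : Maj n (fun i => X (K - i)) := by
  intro s
  obtain ⟨a, b, c, h1, h2, h3, h4, h5, h6, h7, h8⟩ := h (K - s - n + 1)
  refine ⟨K - c, K - b, K - a, by omega, by omega, by omega, by omega, by omega, ?_, ?_, ?_⟩ <;>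
    simpa

theorem Gap.shift {X : ℤ → Prop} (h : Gap X) (K : ℤ) : Gap (fun i => X (K + i)) := by
  intro i j hij h1 h2 h3
  have := h (K + i) (K + j) (by omega) h1 h2 (fun k a b => by
    have := h3 (k - K) (by omega) (by omega)
    simpa using this)
  omega

theorem Gap.neg {X : ℤ → Prop} (h : Gap X) (K : ℤ) : Gap (fun i => X (K - i)) := by
  intro i j hij h1 h2 h3
  have := h (K - j) (K - i) (by omega) h2 h1 (fun k a b => by
    have := h3 (K - k) (by omega) (by omega)
    simpa using this)
  omega

theorem per_shift {n : ℤ} {X : ℤ → Prop} (h : ∀ i, X (i + n) ↔ X i) (K : ℤ) :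
    ∀ i, X (K + (i + n)) ↔ X (K + i) := fun i => by
  rw [← h (K + i), add_assoc]

theorem per_neg {n : ℤ} {X : ℤ → Prop} (h : ∀ i, X (i + n) ↔ X i) (K : ℤ) :
    ∀ i, X (K - (i + n)) ↔ X (K - i) := fun i => by
  rw [← h (K - (i + n))]; congr! 1; ring

structure Pair (n : ℤ) (X Z : ℤ → Prop) : Prop where
  n6 : 6 ≤ n
  ev : n % 2 = 0
  px : ∀ i, X (i + n) ↔ X i
  pz : ∀ i, Z (i + n) ↔ Z i
  mx : Maj n X
  mz : Maj n Z
  gx : Gap X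
  gz : Gap Z
  h2 : ∀ i j k l, Seg X Z i j → Seg X Z k l → j + 2 ≤ k → l + 2 ≤ i + n →
    ((j - i) + (l - k)) % 2 = 0 → n ≤ (j - i) + (l - k) + 4

theorem Pair.swap {n : ℤ} {X Z : ℤ → Prop} (h : Pair n X Z) : Pair n Z X :=
  ⟨h.n6, h.ev, h.pz, h.px, h.mz, h.mx, h.gz, h.gx,
    fun i j k l a b => h.h2 i j k l a.swap b.swap⟩

theorem Pair.shift {n : ℤ} {X Z : ℤ → Prop} (h : Pair n X Z) (K : ℤ) :
    Pair n (fun i => X (K + i)) (fun i => Z (K + i)) :=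
  ⟨h.n6, h.ev, per_shift h.px K, per_shift h.pz K, h.mx.shift K, h.mz.shift K, h.gx.shift K,
    h.gz.shift K, fun i j k l a b c d e => by
      have := h.h2 _ _ _ _ a.shift b.shift (by omega) (by omega) (by omega)
      omega⟩

theorem Pair.neg {n : ℤ} {X Z : ℤ → Prop} (h : Pair n X Z) (K : ℤ) :
    Pair n (fun i => X (K - i)) (fun i => Z (K - i)) :=
  ⟨h.n6, h.ev, per_neg h.px K, per_neg h.pz K, h.mx.neg K, h.mz.neg K, h.gx.neg K,
    h.gz.neg K, fun i j k l a b c d e => by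
      have := h.h2 _ _ _ _ b.neg a.neg (by omega) (by omega) (by omega)
      omega⟩

theorem firstGE {X : ℤ → Prop} {s a : ℤ} (h : X a) (hs : s ≤ a) :
    ∃ i, s ≤ i ∧ i ≤ a ∧ X i ∧ ∀ k, s ≤ k → k < i → ¬ X k := by
  obtain ⟨i, ⟨h1, h2⟩, h3⟩ := Int.exists_least_of_bdd (P := fun i => s ≤ i ∧ X i)
    ⟨s, fun z hz => hz.1⟩ ⟨a, hs, h⟩
  refine ⟨i, h1, h3 a ⟨hs, h⟩, h2, fun k a b c => ?_⟩
  have := h3 k ⟨a, c⟩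
  omega

theorem lastLE {X : ℤ → Prop} {s a : ℤ} (h : X a) (hs : a ≤ s) :
    ∃ i, a ≤ i ∧ i ≤ s ∧ X i ∧ ∀ k, i < k → k ≤ s → ¬ X k := by
  obtain ⟨i, ⟨h1, h2⟩, h3⟩ := Int.exists_greatest_of_bdd (P := fun i => i ≤ s ∧ X i)
    ⟨s, fun z hz => hz.1⟩ ⟨a, hs, h⟩
  refine ⟨i, h3 a ⟨hs, h⟩, h1, h2, fun k a b c => ?_⟩
  have := h3 k ⟨b, c⟩
  omega

def Struct (n : ℤ) (X Z : ℤ → Prop) : Prop :=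
  ∃ w u, 0 ≤ w ∧ w < u ∧ u ≤ n - 1 ∧ (u - w) % 2 = 1 ∧ Z (n - 1) ∧ Z w ∧ X 0 ∧ X u ∧
    (∀ i, 0 ≤ i → i < n → Z i → i ≤ w ∨ i = n - 1) ∧
    (∀ i, 0 ≤ i → i < n → X i → i = 0 ∨ u ≤ i) ∧ (Z 0 ∨ X (n - 1))

theorem struct_aux {n : ℤ} {X Z : ℤ → Prop} (h : Pair n X Z) (l p t : ℤ)
    (x0 : X 0) (xl : X l) (hl : ∀ k, 0 < k → k < l → ¬ X k) (hp0 : 0 ≤ p) (hpt : p + 2 ≤ t)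
    (htl : t ≤ l) (zp : Z p) (zt : Z t) (fp : ∀ k, 0 ≤ k → k < p → ¬ Z k)
    (lt : ∀ k, t < k → k ≤ l → ¬ Z k) (ep : p % 2 = 0) (oq : (l - t) % 2 = 1) :
    Struct n X Z := by
  have hn6 := h.n6
  have hev := h.ev
  have xn : X n := by have := (h.px 0).2 x0; rwa [zero_add] at this
  have lodd := h.gx 0 l (by omega) x0 xl hl
  obtain ⟨A, B, D, a1, a2, a3, a4, a5, XA, XB, XD⟩ := h.mx 1
  have hA : l ≤ A := by
    by_contra hh; exact hl A (by omega) (by omega) XA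
  have sP : Seg X Z 0 p := Or.inl ⟨hp0, x0, zp, fun k a b => hl k (by omega) (by omega),
    fun k a b => fp k a b⟩
  have sQ : Seg X Z t l := Or.inr ⟨htl, zt, xl, lt, fun k a b => hl k (by omega) b⟩
  have Rev : ∀ r1 r2, l ≤ r1 → r2 ≤ n → Seg X Z r1 r2 → (r2 - r1) % 2 = 0 → n - 1 ≤ r2 := by
    intro r1 r2 b1 b2 b3 b4
    by_contra hh
    have := h.h2 0 p r1 r2 sP b3 (by omega) (by omega) (by omega)
    omega
  have Rodd : ∀ r1 r2, l ≤ r1 → r2 ≤ n → Seg X Z r1 r2 → (r2 - r1) % 2 = 1 → r1 ≤ l + 1 := by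
    intro r1 r2 b1 b2 b3 b4
    by_contra hh
    have := h.h2 t l r1 r2 sQ b3 (by omega) (by omega) (by omega)
    have e1 : r1 = l + 2 := by omega
    have e2 : r2 = n := by omega
    rcases b3 with ⟨_, q1, q2, q3, q4⟩ | ⟨_, q1, q2, q3, q4⟩
    · exact q3 n (by omega) (by omega) xn
    · have := q4 B (by omega); grind
  have zn : Z (p + n) := (h.pz p).2 zp
  have zn0 : ∀ k, n ≤ k → k < p + n → ¬ Z k := fun k a b c => by
    have := h.pz (k - n); rw [sub_add_cancel] at this
    exact fp (k - n) (by omega) (by omega) (this.1 c)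
  have T : ∃ z, l < z ∧ z < n ∧ Z z := by
    by_contra hh
    push Not at hh
    have := h.gz t (p + n) (by omega) zt zn (fun k a b => by
      rcases le_or_gt k l with c | c
      · exact lt k a c
      · rcases lt_or_ge k n with d | d
        · exact hh k c d
        · exact zn0 k d b)
    omega
  obtain ⟨z0, z1, z2, z3⟩ := T
  obtain ⟨m, m1, m2, Zm, m4⟩ := firstGE (s := l + 1) z3 (by omega)
  obtain ⟨g, g1, g2, Xg, g4⟩ := lastLE (s := m) xl (by omega)
  have sR : Seg X Z g m := Or.inl ⟨g2, Xg, Zm, g4, fun k a b => by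
    rcases le_or_gt k l with c | c
    · exact lt k (by omega) c
    · exact m4 k (by omega) b⟩
  rcases Int.emod_two_eq_zero_or_one (m - g) with e | e
  · have := Rev g m g1 (by omega) sR e
    have hm : m = n - 1 := by omega
    subst hm
    refine ⟨t, l, by omega, by omega, by omega, oq, Zm, zt, x0, xl, ?_, ?_, ?_⟩
    · intro i i1 i2 i3
      by_contra hh
      rcases le_or_gt i l with c | c
      · exact lt i (by omega) c i3
      · exact m4 i (by omega) (by omega) i3
    · intro i i1 i2 i3
      by_contra hh
      exact hl i (by omega) (by omega) i3
    · by_contra hh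
      push Not at hh
      have zn' : ¬ Z n := by
        have := h.pz 0; rw [zero_add] at this; rw [this]; exact hh.1
      have := Rodd (n - 1) n (by omega) (by omega) (Or.inr ⟨by omega, Zm, xn, fun k a b => by
        obtain rfl : k = n := by omega
        exact zn', fun k a b => by
        obtain rfl : k = n - 1 := by omega
        exact hh.2⟩) (by omega)
      omega
  · have hg := Rodd g m g1 (by omega) sR e
    obtain ⟨g', f1, f2, Xg', f4⟩ := firstGE (s := m) xn (by omega)
    have hm : g < m := by omega
    have hnone : ∀ k, g < k → k < g' → ¬ X k := fun k a b => by
      rcases le_or_gt k m with c | c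
      · exact g4 k a c
      · exact f4 k c.le b
    have og := h.gx g g' (by omega) Xg Xg' hnone
    by_cases hg' : n - 1 ≤ g'
    · have c1 := hnone A
      have c2 := hnone B
      have c3 := hnone D
      have : B ≥ g' := by by_contra hh; exact c2 (by omega) (by omega) XB
      omega
    · obtain ⟨s, s1, s2, Zs, s4⟩ := lastLE (s := g') Zm (by omega)
      have sS : Seg X Z s g' := Or.inr ⟨s2, Zs, Xg', s4, fun k a b => f4 k (by omega) b⟩
      rcases Int.emod_two_eq_zero_or_one (g' - s) with e' | e'
      · have := Rev s g' (by omega) (by omega) sS e'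
        omega
      · have := Rodd s g' (by omega) (by omega) sS e'
        omega

def Wide (X Z : ℤ → Prop) : Prop :=
  ∃ a b t t', X a ∧ X b ∧ a < b ∧ (∀ k, a < k → k < b → ¬ X k) ∧ a ≤ t ∧ t + 2 ≤ t' ∧ t' ≤ b ∧
    Z t ∧ Z t'

def StructK (n : ℤ) (X Z : ℤ → Prop) : Prop :=
  ∃ K, Struct n (fun i => X (K + i)) (fun i => Z (K + i)) ∨
    Struct n (fun i => X (K - i)) (fun i => Z (K - i))

theorem Struct.swap {n : ℤ} {X Z : ℤ → Prop} (h : Struct n X Z) :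
    Struct n (fun i => Z (n - 1 - i)) (fun i => X (n - 1 - i)) := by
  obtain ⟨w, u, h1, h2, h3, h4, h5, h6, h7, h8, h9, h10, h11⟩ := h
  refine ⟨n - 1 - u, n - 1 - w, by omega, by omega, by omega, by omega, ?_, ?_, ?_, ?_,
    fun i a b c => ?_, fun i a b c => ?_, ?_⟩
  · simpa using h7
  · simpa using h8
  · simpa using h5
  · simpa using h6
  · have := h10 (n - 1 - i) (by omega) (by omega) c
    omega
  · have := h9 (n - 1 - i) (by omega) (by omega) c
    omega
  · rcases h11 with h | h
    · right; simpa using h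
    · left; simpa using h

theorem StructK.swap {n : ℤ} {X Z : ℤ → Prop} (h : StructK n Z X) : StructK n X Z := by
  obtain ⟨K, h | h⟩ := h
  · refine ⟨K + (n - 1), Or.inr ?_⟩
    have := h.swap
    simpa only [← add_sub_assoc] using this
  · refine ⟨K - (n - 1), Or.inl ?_⟩
    have := h.swap
    simpa only [← sub_add] using this

theorem struct_of_wide {n : ℤ} {X Z : ℤ → Prop} (h : Pair n X Z) (hw : Wide X Z) :
    StructK n X Z := by
  have hn6 := h.n6
  have hev := h.ev
  obtain ⟨a, b, t, t', Xa, Xb, hab, hno, hat, htt, htb, Zt, Zt'⟩ := hw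
  obtain ⟨p, p1, p2, Zp, p4⟩ := firstGE (s := a) Zt hat
  obtain ⟨q, q1, q2, Zq, q4⟩ := lastLE (s := b) Zt' htb
  have lodd := h.gx a b hab Xa Xb hno
  obtain ⟨A, B, D, a1, a2, a3, a4, a5, XA, XB, XD⟩ := h.mx (a + 1)
  have hA : b ≤ A := by
    by_contra hh; exact hno A (by omega) (by omega) XA
  have sP : Seg X Z a p := Or.inl ⟨p1, Xa, Zp, fun k a b => hno k (by omega) (by omega),
    fun k a b => p4 k a b⟩
  have sQ : Seg X Z q b := Or.inr ⟨q2, Zq, Xb, q4, fun k a b => hno k (by omega) b⟩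
  have hpar : ((p - a) + (b - q)) % 2 ≠ 0 := fun e => by
    have := h.h2 a p q b sP sQ (by omega) (by omega) e
    omega
  rcases Int.emod_two_eq_zero_or_one (p - a) with e | e
  · refine ⟨a, Or.inl ?_⟩
    refine struct_aux (h.shift a) (b - a) (p - a) (q - a) ?_ ?_ ?_ (by omega) (by omega)
      (by omega) ?_ ?_ ?_ ?_ e (by omega)
    · simpa using Xa
    · simpa using Xb
    · intro k k1 k2; exact hno _ (by omega) (by omega)
    · simpa using Zp
    · simpa using Zq
    · intro k k1 k2; exact p4 _ (by omega) (by omega)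
    · intro k k1 k2; exact q4 _ (by omega) (by omega)
  · refine ⟨b, Or.inr ?_⟩
    refine struct_aux (h.neg b) (b - a) (b - q) (b - p) ?_ ?_ ?_ (by omega) (by omega)
      (by omega) ?_ ?_ ?_ ?_ (by omega) (by omega)
    · simpa using Xb
    · simpa using Xa
    · intro k k1 k2; exact hno _ (by omega) (by omega)
    · simpa using Zq
    · simpa using Zp
    · intro k k1 k2; exact q4 _ (by omega) (by omega)
    · intro k k1 k2; exact p4 _ (by omega) (by omega)

theorem common_aux {n : ℤ} {X Z : ℤ → Prop} (h : Pair n X Z)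
    (NW1 : ∀ a b t t', X a → X b → a < b → (∀ k, a < k → k < b → ¬ X k) → a ≤ t → t' ≤ b →
      Z t → Z t' → t' ≤ t + 1)
    (NW2 : ∀ a b t t', Z a → Z b → a < b → (∀ k, a < k → k < b → ¬ Z k) → a ≤ t → t' ≤ b →
      X t → X t' → t' ≤ t + 1)
    (x0 : X 0) (z0 : Z 0) (gx gz : ℤ) (gx2 : 2 ≤ gx) (gxz : gx < gz) (gzn : gz ≤ n - 2)
    (Xgx : X gx) (Zgz : Z gz) (fx : ∀ k, 2 ≤ k → k < gx → ¬ X k)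
    (fz : ∀ k, 2 ≤ k → k < gz → ¬ Z k) : False := by
  have hn6 := h.n6
  have hev := h.ev
  have xn : X n := by have := (h.px 0).2 x0; rwa [zero_add] at this
  have zn : Z n := by have := (h.pz 0).2 z0; rwa [zero_add] at this
  have s0 : Seg X Z 0 0 := Or.inl ⟨le_rfl, x0, z0, by intros; omega, by intros; omega⟩
  have sodd : ∀ i j, 2 ≤ i → j ≤ n - 2 → Seg X Z i j → (j - i) % 2 = 1 := by
    intro i j i1 i2 i3
    by_contra hh
    have := h.h2 0 0 i j s0 i3 (by omega) (by omega) (by omega)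
    obtain rfl : i = 2 := by omega
    obtain rfl : j = n - 2 := by omega
    rcases i3 with ⟨_, q1, q2, q3, q4⟩ | ⟨_, q1, q2, q3, q4⟩
    · obtain ⟨A, B, D, a1, a2, a3, a4, a5, XA, XB, XD⟩ := h.mx (-1)
      exact q3 D (by omega) (by omega) XD
    · obtain ⟨A, B, D, a1, a2, a3, a4, a5, XA, XB, XD⟩ := h.mz (-1)
      exact q3 D (by omega) (by omega) XD
  -- `1` is a `Z`-mark
  have z1 : Z 1 := by
    by_contra hh
    have := NW2 0 gz 0 gx z0 Zgz (by omega) (fun k a b => by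
      rcases eq_or_lt_of_le (show 1 ≤ k by omega) with c | c
      · rw [← c]; exact hh
      · exact fz k c b) le_rfl (by omega) x0 Xgx
    omega
  have zgap : ∀ k, 1 < k → k < gz → ¬ Z k := fun k a b => fz k (by omega) b
  have zo := h.gz 1 gz (by omega) z1 Zgz zgap
  obtain ⟨g1, b1, b2, Xg1, b4⟩ := lastLE (s := gz) Xgx (by omega)
  have g1z : g1 ≠ gz := by
    rintro rfl
    have := sodd g1 g1 (by omega) (by omega) (Or.inl ⟨le_rfl, Xg1, Zgz, by intros; omega,
      by intros; omega⟩)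
    omega
  have sS1 : Seg X Z g1 gz := Or.inl ⟨b2, Xg1, Zgz, b4, fun k a b => fz k (by omega) b⟩
  have o1 := sodd g1 gz (by omega) (by omega) sS1
  have g1le := NW2 1 gz gx g1 z1 Zgz (by omega) zgap (by omega) b2 Xgx Xg1
  have x1 : ¬ X 1 := by
    intro x1
    have := NW2 1 gz 1 g1 z1 Zgz (by omega) zgap (by omega) b2 x1 Xg1
    omega
  by_cases hx : ∃ k, gz < k ∧ k ≤ n - 2 ∧ X k
  · obtain ⟨k0, k1, k2, k3⟩ := hx
    obtain ⟨g2, c1, c2, Xg2, c4⟩ := firstGE (s := gz) k3 (by omega)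
    have g2z : g2 ≠ gz := by
      rintro rfl
      exact b4 g2 (by omega) (by omega) Xg2
    have xgap : ∀ k, g1 < k → k < g2 → ¬ X k := fun k a b => by
      rcases le_or_gt k gz with c | c
      · exact b4 k a c
      · exact c4 k c.le b
    have xo := h.gx g1 g2 (by omega) Xg1 Xg2 xgap
    obtain ⟨w, d1, d2, Zw, d4⟩ := lastLE (s := g2) Zgz (by omega)
    have wle := NW1 g1 g2 gz w Xg1 Xg2 (by omega) xgap (by omega) d2 Zgz Zw
    have sS2 : Seg X Z w g2 := Or.inr ⟨d2, Zw, Xg2, d4, fun k a b => c4 k (by omega) b⟩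
    have o2 := sodd w g2 (by omega) (by omega) sS2
    have hw : w = gz + 1 := by omega
    by_cases hz : ∃ k, g2 < k ∧ k ≤ n - 2 ∧ Z k
    · obtain ⟨z0, e1, e2, e3⟩ := hz
      obtain ⟨s, s1, s2, Zs, s4⟩ := firstGE (s := g2) e3 (by omega)
      obtain ⟨r, r1, r2, Xr, r4⟩ := lastLE (s := s) Xg2 (by omega)
      have sS3 : Seg X Z r s := Or.inl ⟨r2, Xr, Zs, r4, fun k a b => s4 k (by omega) b⟩
      have o3 := sodd r s (by omega) (by omega) sS3
      have := h.h2 g1 gz r s sS1 sS3 (by omega) (by omega) (by omega)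
      omega
    · push Not at hz
      by_cases zm : Z (n - 1)
      · have := h.gz w (n - 1) (by omega) Zw zm (fun k a b => by
          rcases le_or_gt k g2 with c | c
          · exact d4 k a c
          · exact hz k c (by omega))
        omega
      · have := NW2 w n g2 n Zw zn (by omega) (fun k a b => by
          rcases le_or_gt k g2 with c | c
          · exact d4 k a c
          · rcases le_or_gt k (n - 2) with d | d
            · exact hz k c (by omega)
            · obtain rfl : k = n - 1 := by omega
              exact zm) (by omega) le_rfl Xg2 xn
        omega
  · push Not at hx
    have xm : X (n - 1) := by
      by_contra hh
      have := NW1 g1 n gz n Xg1 xn (by omega) (fun k a b => by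
        rcases le_or_gt k gz with c | c
        · exact b4 k a c
        · rcases le_or_gt k (n - 2) with d | d
          · exact hx k c (by omega)
          · obtain rfl : k = n - 1 := by omega
            exact hh) (by omega) le_rfl Zgz zn
      omega
    have xgap : ∀ k, g1 < k → k < n - 1 → ¬ X k := fun k a b => by
      rcases le_or_gt k gz with c | c
      · exact b4 k a c
      · exact hx k c (by omega)
    have zz : ∀ k, gz ≤ k → k ≤ n - 1 → Z k → k ≤ gz + 1 := fun k a b c =>
      NW1 g1 (n - 1) gz k Xg1 xm (by omega) xgap (by omega) b Zgz c
    obtain ⟨A, B, D, a1, a2, a3, a4, a5, ZA, ZB, ZD⟩ := h.mz 0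
    have h1 : A = 0 ∨ A = 1 ∨ gz ≤ A := by
      by_contra hh; exact fz A (by omega) (by omega) ZA
    have h2 : B = 0 ∨ B = 1 ∨ gz ≤ B := by
      by_contra hh; exact fz B (by omega) (by omega) ZB
    have := zz D (by omega) (by omega) ZD
    omega

theorem run_step {n : ℤ} {X Z : ℤ → Prop} (h : Pair n X Z)
    (NW1 : ∀ a b t t', X a → X b → a < b → (∀ k, a < k → k < b → ¬ X k) → a ≤ t → t' ≤ b →
      Z t → Z t' → t' ≤ t + 1)
    (nb : ∀ i, ¬ (X i ∧ Z i)) {e s : ℤ} (hs : SegD X Z e s) :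
    ∃ e' s', SegD Z X e' s' ∧ e < s ∧ s ≤ e' ∧ e' ≤ s + 1 ∧ e' < s' ∧ (s' - e) % 2 = 1 := by
  obtain ⟨h1, h2, h3, h4, h5⟩ := hs
  have hes : e ≠ s := by rintro rfl; exact nb e ⟨h2, h3⟩
  obtain ⟨A, B, D, a1, a2, a3, a4, a5, XA, XB, XD⟩ := h.mx s
  obtain ⟨s', b1, b2, Xs', b4⟩ := firstGE (s := s) XA (by omega)
  have hss : s ≠ s' := by rintro rfl; exact nb s ⟨Xs', h3⟩
  obtain ⟨e', c1, c2, Ze', c4⟩ := lastLE (s := s') h3 b1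
  have hee : e' ≠ s' := by rintro rfl; exact nb e' ⟨Xs', Ze'⟩
  have gap : ∀ k, e < k → k < s' → ¬ X k := fun k a b => by
    rcases le_or_gt k s with c | c
    · exact h4 k a c
    · exact b4 k c.le b
  refine ⟨e', s', ⟨c2, Ze', Xs', c4, fun k a b => b4 k (by omega) b⟩, by omega, c1, ?_, by omega,
    h.gx e s' (by omega) h2 Xs' gap⟩
  exact NW1 e s' s e' h2 Xs' (by omega) gap h1 c2 h3 Ze'

theorem nocommon_aux {n : ℤ} {X Z : ℤ → Prop} (h : Pair n X Z)
    (NW1 : ∀ a b t t', X a → X b → a < b → (∀ k, a < k → k < b → ¬ X k) → a ≤ t → t' ≤ b →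
      Z t → Z t' → t' ≤ t + 1)
    (NW2 : ∀ a b t t', Z a → Z b → a < b → (∀ k, a < k → k < b → ¬ Z k) → a ≤ t → t' ≤ b →
      X t → X t' → t' ≤ t + 1)
    (nb : ∀ i, ¬ (X i ∧ Z i)) : False := by
  have hn6 := h.n6
  have nb' : ∀ i, ¬ (Z i ∧ X i) := fun i hh => nb i hh.symm
  obtain ⟨A, _, _, _, _, _, _, _, XA, _, _⟩ := h.mx 0
  obtain ⟨B, _, _, hB, _, _, _, _, ZB, _, _⟩ := h.mz A
  obtain ⟨s1, b1, b2, Zs1, b4⟩ := firstGE (s := A) ZB hB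
  obtain ⟨e0, c1, c2, Xe0, c4⟩ := lastLE (s := s1) XA b1
  have S0 : SegD X Z e0 s1 := ⟨c2, Xe0, Zs1, c4, fun k a b => b4 k (by omega) b⟩
  obtain ⟨e1, s2, S1, p01, p02, p03, p04, q0⟩ := run_step h NW1 nb S0
  obtain ⟨e2, s3, S2, p11, p12, p13, p14, q1⟩ := run_step h.swap NW2 nb' S1
  obtain ⟨e3, s4, S3, p21, p22, p23, p24, q2⟩ := run_step h NW1 nb S2
  obtain ⟨e4, s5, S4, p31, p32, p33, p34, q3⟩ := run_step h.swap NW2 nb' S3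
  obtain ⟨e5, s6, S5, p41, p42, p43, p44, q4⟩ := run_step h NW1 nb S4
  have hN : s6 ≤ e0 + n := by
    by_contra hh
    have key : ∀ k, e0 < k → k < s6 → X k → (s2 ≤ k ∧ k ≤ e2) ∨ (s4 ≤ k ∧ k ≤ e4) := by
      intro k k1 k2 k3
      by_contra hc
      rcases le_or_gt k s1 with c | c
      · exact S0.2.2.2.1 k k1 c k3
      rcases lt_or_ge k s2 with c | c
      · exact S1.2.2.2.2 k (by omega) c k3
      rcases le_or_gt k s3 with c | c
      · exact S2.2.2.2.1 k (by omega) c k3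
      rcases lt_or_ge k s4 with c | c
      · exact S3.2.2.2.2 k (by omega) c k3
      rcases le_or_gt k s5 with c | c
      · exact S4.2.2.2.1 k (by omega) c k3
      · exact S5.2.2.2.2 k (by omega) k2 k3
    obtain ⟨A, B, D, a1, a2, a3, a4, a5, XA, XB, XD⟩ := h.mx (e0 + 1)
    have k1 := key A (by omega) (by omega) XA
    have k2 := key B (by omega) (by omega) XB
    have k3 := key D (by omega) (by omega) XD
    omega
  have h02 := h.h2 e0 s1 e2 s3 (Or.inl S0) (Or.inl S2)
  have h13 := h.h2 e1 s2 e3 s4 (Or.inr S1) (Or.inr S3)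
  have h24 := h.h2 e2 s3 e4 s5 (Or.inl S2) (Or.inl S4)
  have h03 := h.h2 e0 s1 e3 s4 (Or.inl S0) (Or.inr S3)
  have h14 := h.h2 e1 s2 e4 s5 (Or.inr S1) (Or.inl S4)
  have h25 := h.h2 e2 s3 e5 s6 (Or.inl S2) (Or.inr S5)
  have r03 : ((s1 - e0) + (s4 - e3)) % 2 = 1 := by
    by_contra hh
    have := h03 (by omega) (by omega) (by omega)
    omega
  have r14 : ((s2 - e1) + (s5 - e4)) % 2 = 1 := by
    by_contra hh
    have := h14 (by omega) (by omega) (by omega)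
    omega
  have r25 : ((s3 - e2) + (s6 - e5)) % 2 = 1 := by
    by_contra hh
    have := h25 (by omega) (by omega) (by omega)
    omega
  have r02 : ((s1 - e0) + (s3 - e2)) % 2 = 0 → e2 ≤ s1 + 1 := by
    intro hh
    by_contra hc
    have := h02 (by omega) (by omega) (by omega)
    omega
  have r13 : ((s2 - e1) + (s4 - e3)) % 2 = 0 → e3 ≤ s2 + 1 := by
    intro hh
    by_contra hc
    have := h13 (by omega) (by omega) (by omega)
    omega
  have r24 : ((s3 - e2) + (s5 - e4)) % 2 = 0 → e4 ≤ s3 + 1 := by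
    intro hh
    by_contra hc
    have := h24 (by omega) (by omega) (by omega)
    omega
  rcases Int.emod_two_eq_zero_or_one (s1 - e0) with f0 | f0 <;>
  rcases Int.emod_two_eq_zero_or_one (s2 - e1) with f1 | f1 <;>
  rcases Int.emod_two_eq_zero_or_one (s3 - e2) with f2 | f2 <;> omega

theorem pair_struct {n : ℤ} {X Z : ℤ → Prop} (h : Pair n X Z) : StructK n X Z := by
  by_contra hcon
  have NW1 : ∀ a b t t', X a → X b → a < b → (∀ k, a < k → k < b → ¬ X k) → a ≤ t → t' ≤ b →
      Z t → Z t' → t' ≤ t + 1 := by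
    intro a b t t' h1 h2 h3 h4 h5 h6 h7 h8
    by_contra hh
    exact hcon (struct_of_wide h ⟨a, b, t, t', h1, h2, h3, h4, h5, by omega, h6, h7, h8⟩)
  have NW2 : ∀ a b t t', Z a → Z b → a < b → (∀ k, a < k → k < b → ¬ Z k) → a ≤ t → t' ≤ b →
      X t → X t' → t' ≤ t + 1 := by
    intro a b t t' h1 h2 h3 h4 h5 h6 h7 h8
    by_contra hh
    exact hcon (struct_of_wide h.swap ⟨a, b, t, t', h1, h2, h3, h4, h5, by omega, h6, h7, h8⟩).swap
  by_cases hb : ∃ c, X c ∧ Z c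
  · obtain ⟨c, xc, zc⟩ := hb
    have hs := h.shift c
    have hn6 := h.n6
    have M1 : ∀ a b t t', X (c + a) → X (c + b) → a < b →
        (∀ k, a < k → k < b → ¬ X (c + k)) → a ≤ t → t' ≤ b →
        Z (c + t) → Z (c + t') → t' ≤ t + 1 := by
      intro a b t t' h1 h2 h3 h4 h5 h6 h7 h8
      have := NW1 (c + a) (c + b) (c + t) (c + t') h1 h2 (by omega) (fun k k1 k2 => by
        have := h4 (k - c) (by omega) (by omega)
        simpa using this) (by omega) (by omega) h7 h8
      omega
    have M2 : ∀ a b t t', Z (c + a) → Z (c + b) → a < b →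
        (∀ k, a < k → k < b → ¬ Z (c + k)) → a ≤ t → t' ≤ b →
        X (c + t) → X (c + t') → t' ≤ t + 1 := by
      intro a b t t' h1 h2 h3 h4 h5 h6 h7 h8
      have := NW2 (c + a) (c + b) (c + t) (c + t') h1 h2 (by omega) (fun k k1 k2 => by
        have := h4 (k - c) (by omega) (by omega)
        simpa using this) (by omega) (by omega) h7 h8
      omega
    have x0 : X (c + 0) := by simpa using xc
    have z0 : Z (c + 0) := by simpa using zc
    obtain ⟨_, _, D, _, _, _, _, _, _, _, XD⟩ := hs.mx (-1)
    obtain ⟨_, _, E, _, _, _, _, _, _, _, ZE⟩ := hs.mz (-1)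
    obtain ⟨gx, b1, b2, b3, b4⟩ := firstGE (X := fun i => X (c + i)) (s := 2) XD (by omega)
    obtain ⟨gz, c1, c2, c3, c4⟩ := firstGE (X := fun i => Z (c + i)) (s := 2) ZE (by omega)
    rcases lt_trichotomy gx gz with hlt | heq | hlt
    · exact common_aux hs M1 M2 x0 z0 gx gz b1 hlt (by omega) b3 c3 b4 c4
    · subst heq
      have := hs.h2 0 0 gx gx (Or.inl ⟨le_rfl, x0, z0, by intros; omega, by intros; omega⟩)
        (Or.inl ⟨le_rfl, b3, c3, by intros; omega, by intros; omega⟩) (by omega) (by omega)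
        (by omega)
      omega
    · exact common_aux hs.swap M2 M1 z0 x0 gz gx c1 hlt (by omega) c3 b3 c4 b4
  · push Not at hb
    exact nocommon_aux h NW1 NW2 (fun i hh => hb i hh.1 hh.2)

theorem per_sub {n : ℤ} {X : ℤ → Prop} (h : ∀ i, X (i + n) ↔ X i) (i : ℤ) : X (i - n) ↔ X i := by
  rw [← h (i - n), sub_add_cancel]

theorem per_mul {n : ℤ} {X : ℤ → Prop} (h : ∀ i, X (i + n) ↔ X i) (m i : ℤ) :
    X (i + m * n) ↔ X i := by
  induction m using Int.induction_on with
  | zero => simp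
  | succ k ih => rw [← ih, ← h (i + k * n)]; congr! 1; ring
  | pred k ih => rw [← ih, ← h (i + (-(k : ℤ) - 1) * n)]; congr! 1; ring

/-- unshifted, positively oriented structure -/
def SP (n : ℤ) (X Z : ℤ → Prop) (k w u : ℤ) : Prop :=
  k ≤ w ∧ w < u ∧ u ≤ k + n - 1 ∧ (u - w) % 2 = 1 ∧ Z (k - 1) ∧ Z w ∧ X k ∧ X u ∧
    (∀ i, k ≤ i → i < k + n → Z i → i ≤ w ∨ i = k + n - 1) ∧
    (∀ i, k ≤ i → i < k + n → X i → i = k ∨ u ≤ i) ∧ (Z k ∨ X (k - 1))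

def SN (n : ℤ) (X Z : ℤ → Prop) (k w u : ℤ) : Prop :=
  w ≤ k ∧ u < w ∧ k - n + 1 ≤ u ∧ (w - u) % 2 = 1 ∧ Z (k + 1) ∧ Z w ∧ X k ∧ X u ∧
    (∀ i, i ≤ k → k - n < i → Z i → w ≤ i ∨ i = k - n + 1) ∧
    (∀ i, i ≤ k → k - n < i → X i → i = k ∨ i ≤ u) ∧ (Z k ∨ X (k + 1))

theorem norm_exists {n : ℤ} (hn : 0 < n) (s k : ℤ) : ∃ m, s ≤ k + m * n ∧ k + m * n < s + n := by
  refine ⟨-((k - s) / n), ?_, ?_⟩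
  · have := Int.emod_add_mul_ediv (k - s) n
    have := Int.emod_nonneg (k - s) hn.ne'
    linarith [mul_comm n ((k-s)/n)]
  · have := Int.emod_add_mul_ediv (k - s) n
    have := Int.emod_lt_of_pos (k - s) hn
    linarith [mul_comm n ((k-s)/n)]

theorem StructK.norm {n : ℤ} {X Z : ℤ → Prop} (hn : 0 < n) (px : ∀ i, X (i + n) ↔ X i)
    (pz : ∀ i, Z (i + n) ↔ Z i) (h : StructK n X Z) (s s' : ℤ) :
    ∃ k w u, (s ≤ k ∧ k < s + n ∧ SP n X Z k w u) ∨ (s' ≤ k ∧ k < s' + n ∧ SN n X Z k w u) := by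
  obtain ⟨K, h | h⟩ := h
  · obtain ⟨w, u, h1, h2, h3, h4, h5, h6, h7, h8, h9, h10, h11⟩ := h
    obtain ⟨m, m1, m2⟩ := norm_exists hn s K
    have ex : ∀ i j, i = j + m * n → (X i ↔ X j) := fun i j e => by rw [e, per_mul px]
    have ez : ∀ i j, i = j + m * n → (Z i ↔ Z j) := fun i j e => by rw [e, per_mul pz]
    have ez' : Z (K + (n - 1)) ↔ Z (K - 1) := by rw [← pz (K - 1)]; congr! 1; ring
    have ex' : X (K + (n - 1)) ↔ X (K - 1) := by rw [← px (K - 1)]; congr! 1; ring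
    refine ⟨K + m * n, K + w + m * n, K + u + m * n, Or.inl ⟨m1, m2, by omega, by omega, by omega,
      by omega, ?_, ?_, ?_, ?_, fun i a b c => ?_, fun i a b c => ?_, ?_⟩⟩
    · rw [ez _ (K - 1) (by ring)]; exact ez'.1 h5
    · rw [ez _ (K + w) (by ring)]; exact h6
    · rw [ex _ (K + 0) (by ring)]; exact h7
    · rw [ex _ (K + u) (by ring)]; exact h8
    · have := h9 (i - m * n - K) (by omega) (by omega) ((ez _ _ (by ring)).1 c)
      omega
    · have := h10 (i - m * n - K) (by omega) (by omega) ((ex _ _ (by ring)).1 c)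
      omega
    · rw [ez _ (K + 0) (by ring), ex _ (K - 1) (by ring), ← ex']; exact h11
  · obtain ⟨w, u, h1, h2, h3, h4, h5, h6, h7, h8, h9, h10, h11⟩ := h
    obtain ⟨m, m1, m2⟩ := norm_exists hn s' K
    have ex : ∀ i j, i = j + m * n → (X i ↔ X j) := fun i j e => by rw [e, per_mul px]
    have ez : ∀ i j, i = j + m * n → (Z i ↔ Z j) := fun i j e => by rw [e, per_mul pz]
    have ez' : Z (K - (n - 1)) ↔ Z (K + 1) := by rw [← pz (K - (n - 1))]; congr! 1; ring
    have ex' : X (K - (n - 1)) ↔ X (K + 1) := by rw [← px (K - (n - 1))]; congr! 1; ring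
    refine ⟨K + m * n, K - w + m * n, K - u + m * n, Or.inr ⟨m1, m2, by omega, by omega, by omega,
      by omega, ?_, ?_, ?_, ?_, fun i a b c => ?_, fun i a b c => ?_, ?_⟩⟩
    · rw [ez _ (K + 1) (by ring)]; exact ez'.1 h5
    · rw [ez _ (K - w) (by ring)]; exact h6
    · rw [ex _ (K - 0) (by ring)]; exact h7
    · rw [ex _ (K - u) (by ring)]; exact h8
    · have := h9 (K - (i - m * n)) (by omega) (by omega) ((ez _ _ (by ring)).1 c)
      omega
    · have := h10 (K - (i - m * n)) (by omega) (by omega) ((ex _ _ (by ring)).1 c)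
      omega
    · rw [ez _ (K - 0) (by ring), ex _ (K + 1) (by ring), ← ex']; exact h11

structure TA (n : ℤ) (X Y Z : ℤ → Prop) : Prop where
  pxz : Pair n X Z
  pyz : Pair n Y Z
  h3 : ∀ i j, Seg X Y i j → (j - i) % 2 = 1 → n ≤ j - i + 3
  h4 : ∀ i j k l, Seg X Z i j → (∀ t, i ≤ t → t ≤ j → ¬ Y t) → Seg Y Z k l →
    (∀ t, k ≤ t → t ≤ l → ¬ X t) → (j + 2 ≤ k ∧ l + 2 ≤ i + n) ∨ (l + 2 ≤ i ∧ j + 2 ≤ k + n) →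
    ((j - i) + (l - k)) % 2 = 1 → n ≤ (j - i) + (l - k) + 5

structure TB (n : ℤ) (X Y Z : ℤ → Prop) : Prop where
  pxz : Pair n X Z
  pyz : Pair n Y Z
  pxy : Pair n X Y
  h5 : ∀ a b c, Y a → Z a → ¬ X a → X b → Z b → ¬ Y b → X c → Y c → ¬ Z c →
    (a + 2 ≤ c ∧ c + 2 ≤ b ∧ b + 2 ≤ a + n) ∨ (b + 2 ≤ c ∧ c + 2 ≤ a ∧ a + 2 ≤ b + n) → n ≤ 6

theorem TA.shift {n : ℤ} {X Y Z : ℤ → Prop} (h : TA n X Y Z) (K : ℤ) :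
    TA n (fun i => X (K + i)) (fun i => Y (K + i)) (fun i => Z (K + i)) :=
  ⟨h.pxz.shift K, h.pyz.shift K, fun i j a b => by
    have := h.h3 _ _ a.shift (by omega)
    omega, fun i j k l a1 a2 a3 a4 a5 a6 => by
    have := h.h4 _ _ _ _ a1.shift (fun t u v => by
      have := a2 (t - K) (by omega) (by omega); simpa using this) a3.shift (fun t u v => by
      have := a4 (t - K) (by omega) (by omega); simpa using this) (by omega) (by omega)
    omega⟩

theorem TA.neg {n : ℤ} {X Y Z : ℤ → Prop} (h : TA n X Y Z) (K : ℤ) :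
    TA n (fun i => X (K - i)) (fun i => Y (K - i)) (fun i => Z (K - i)) :=
  ⟨h.pxz.neg K, h.pyz.neg K, fun i j a b => by
    have := h.h3 _ _ a.neg (by omega)
    omega, fun i j k l a1 a2 a3 a4 a5 a6 => by
    have := h.h4 _ _ _ _ a1.neg (fun t u v => by
      have := a2 (K - t) (by omega) (by omega); simpa using this) a3.neg (fun t u v => by
      have := a4 (K - t) (by omega) (by omega); simpa using this) (by omega) (by omega)
    omega⟩

theorem TB.shift {n : ℤ} {X Y Z : ℤ → Prop} (h : TB n X Y Z) (K : ℤ) :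
    TB n (fun i => X (K + i)) (fun i => Y (K + i)) (fun i => Z (K + i)) :=
  ⟨h.pxz.shift K, h.pyz.shift K, h.pxy.shift K, fun a b c a1 a2 a3 a4 a5 a6 a7 a8 a9 a10 =>
    h.h5 (K + a) (K + b) (K + c) a1 a2 a3 a4 a5 a6 a7 a8 a9 (by omega)⟩

theorem TB.neg {n : ℤ} {X Y Z : ℤ → Prop} (h : TB n X Y Z) (K : ℤ) :
    TB n (fun i => X (K - i)) (fun i => Y (K - i)) (fun i => Z (K - i)) :=
  ⟨h.pxz.neg K, h.pyz.neg K, h.pxy.neg K, fun a b c a1 a2 a3 a4 a5 a6 a7 a8 a9 a10 =>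
    h.h5 (K - a) (K - b) (K - c) a1 a2 a3 a4 a5 a6 a7 a8 a9 (by omega)⟩

/-- the normalised structure of `X, Z` -/
structure Std (n : ℤ) (X Z : ℤ → Prop) (w u : ℤ) : Prop where
  w4 : 4 ≤ w
  wu : w < u
  un : u + 5 ≤ n
  we : w % 2 = 0
  uo : u % 2 = 1
  z1 : Z (n - 1)
  zw : Z w
  x0 : X 0
  xu : X u
  az : ∀ i, 0 ≤ i → i < n → Z i → i ≤ w ∨ i = n - 1
  ax : ∀ i, 0 ≤ i → i < n → X i → i = 0 ∨ u ≤ i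
  cm : Z 0 ∨ X (n - 1)

theorem Struct.std {n : ℤ} {X Z : ℤ → Prop} (h : Pair n X Z) (hs : Struct n X Z) :
    ∃ w u, Std n X Z w u := by
  have hn6 := h.n6
  have hev := h.ev
  obtain ⟨w, u, h1, h2, h3, h4, h5, h6, h7, h8, h9, h10, h11⟩ := hs
  have ow := h.gz w (n - 1) (by omega) h6 h5 (fun k a b c => by
    have := h9 k (by omega) (by omega) c; omega)
  have hu : u + 5 ≤ n := by
    obtain ⟨a, b, c, a1, a2, a3, a4, a5, A, B, D⟩ := h.mx 1
    have := h10 a (by omega) (by omega) A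
    omega
  have hw : 3 ≤ w := by
    obtain ⟨a, b, c, a1, a2, a3, a4, a5, A, B, D⟩ := h.mz (-1)
    have := h9 c (by omega) (by omega) D
    omega
  exact ⟨w, u, by omega, by omega, by omega, by omega, by omega, h5, h6, h7, h8, h9, h10, h11⟩

structure PF (n : ℤ) (Y Z : ℤ → Prop) (w k w2 v : ℤ) : Prop where
  kw : k - 1 ≤ w
  w2m : -1 ≤ w2
  wv : w2 < v
  vk : v + 4 ≤ k
  par : (v - w2) % 2 = 1
  zk : Z (k - 1)
  zw : Z w2
  yk : Y k
  yv : Y v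
  cm : Z k ∨ Y (k - 1)
  ay : ∀ i, 0 ≤ i → i < n → Y i → v ≤ i ∧ i ≤ k
  az : ∀ i, w2 < i → i < k - 1 → ¬ Z i

theorem plus_facts {n : ℤ} {X Y Z : ℤ → Prop} (pxz : Pair n X Z) (pyz : Pair n Y Z)
    (nt : ∀ i, X i → Y i → Z i → False) {w u k wk uk : ℤ} (S : Std n X Z w u)
    (k0 : 0 ≤ k) (kn : k < n) (T : SP n Y Z k wk uk) : PF n Y Z w k (wk - n) (uk - n) := by
  obtain ⟨w4, wu, un, we, uo, z1, zw, x0, xu, az, ax, cm⟩ := S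
  obtain ⟨t1, t2, t3, t4, t5, t6, t7, t8, t9, t10, t11⟩ := T
  have sx := per_sub pxz.px
  have sy := per_sub pyz.px
  have sz := per_sub pxz.pz
  have ax1 := pxz.px
  have ay1 := pyz.px
  have az1 := pxz.pz
  have zm : Z (-1) := by have := (sz (n - 1)).2 z1; rwa [sub_sub_cancel_left] at this
  have k1 : 1 ≤ k := by
    by_contra hh
    obtain rfl : k = 0 := by omega
    rcases t11 with h | h
    · exact nt 0 x0 t7 h
    · rcases cm with h' | h'
      · exact nt 0 x0 t7 h'
      · refine nt (n - 1) h' ?_ z1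
        have := (ay1 _).2 h
        convert this using 1; ring
  have hk : k - 1 ≤ w := by
    have := az (k - 1) (by omega) (by omega) t5
    omega
  have hw2 : n - 1 ≤ wk := by
    have := t9 (n - 1) (by omega) (by omega) z1
    omega
  have hay : ∀ i, 0 ≤ i → i < n → Y i → uk - n ≤ i ∧ i ≤ k := by
    intro i a b c
    rcases lt_or_ge i k with h | h
    · have := t10 (i + n) (by omega) (by omega) ((ay1 _).2 c)
      omega
    · have := t10 i (by omega) (by omega) c
      omega
  refine ⟨hk, by omega, by omega, ?_, by omega, t5, (sz _).2 t6, t7, (sy _).2 t8, t11, hay, ?_⟩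
  · obtain ⟨a, b, c, a1, a2, a3, a4, a5, A, B, D⟩ := pyz.mx 0
    have := hay a (by omega) (by omega) A
    have := hay c (by omega) (by omega) D
    omega
  · intro i a b c
    have := t9 (i + n) (by omega) (by omega) ((az1 _).2 c)
    omega

theorem plusA {n : ℤ} {X Y Z : ℤ → Prop} (H : TA n X Y Z)
    (nt : ∀ i, X i → Y i → Z i → False) {w u k w2 v : ℤ} (S : Std n X Z w u)
    (P : PF n Y Z w k w2 v) : False := by
  obtain ⟨w4, wu, un, we, uo, z1, zw, x0, xu, az, ax, cm⟩ := S
  obtain ⟨kw, w2m, wv, vk, par, zk, zw2, yk, yv, cm2, ay, az2⟩ := P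
  have hev := H.pxz.ev
  have sx := per_sub H.pxz.px
  have sy := per_sub H.pyz.px
  have sz := per_sub H.pxz.pz
  have ax1 := H.pxz.px
  have ay1 := H.pyz.px
  have az1 := H.pxz.pz
  have zm : Z (-1) := by have := (sz (n - 1)).2 z1; rwa [sub_sub_cancel_left] at this
  have nX : ∀ i, 0 < i → i < u → ¬ X i := fun i a b c => by
    have := ax i (by omega) (by omega) c; omega
  have nZ : ∀ i, w < i → i < n - 1 → ¬ Z i := fun i a b c => by
    have := az i (by omega) (by omega) c; omega
  have nY : ∀ i, 0 ≤ i → i < v → ¬ Y i := fun i a b c => by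
    have := ay i (by omega) (by omega) c; omega
  have nY2 : ∀ i, k < i → i < n → ¬ Y i := fun i a b c => by
    have := ay i (by omega) (by omega) c; omega
  have ve : v % 2 = 0 := by
    by_contra hh
    have := H.h3 0 v (Or.inl ⟨by omega, x0, yv, fun t a b => nX t (by omega) (by omega),
      fun t a b => nY t (by omega) (by omega)⟩) (by omega)
    omega
  have ko : k % 2 = 1 := by
    by_contra hh
    have := H.h3 k u (Or.inr ⟨by omega, yk, xu, fun t a b => nY2 t (by omega) (by omega),
      fun t a b => nX t (by omega) (by omega)⟩) (by omega)
    omega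
  have s1 : Seg X Z w u := Or.inr ⟨by omega, zw, xu, fun t a b => nZ t (by omega) (by omega),
    fun t a b => nX t (by omega) (by omega)⟩
  rcases le_or_gt (k + 1) w with hw | hw
  · have q1 : ∀ t, w ≤ t → t ≤ u → ¬ Y t := fun t a b => nY2 t (by omega) (by omega)
    by_cases hy : Y (k - 1)
    · have := H.h4 w u (k - 1) (k - 1) s1 q1 (Or.inl ⟨le_rfl, hy, zk, fun t a b => by omega,
        fun t a b => by omega⟩) (fun t a b => nX t (by omega) (by omega)) (by omega) (by omega)
      omega
    · have hz : Z k := cm2.resolve_right hy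
      rcases le_or_gt (k + 2) w with hw' | hw'
      · have := H.h4 w u k k s1 q1 (Or.inl ⟨le_rfl, yk, hz, fun t a b => by omega,
          fun t a b => by omega⟩) (fun t a b => nX t (by omega) (by omega)) (by omega) (by omega)
        omega
      · obtain ⟨v1, b1, b2, b3, b4⟩ := lastLE (s := k - 2) yv (by omega)
        have g := H.pyz.gx v1 k (by omega) b3 yk (fun t a b => by
          rcases eq_or_ne t (k - 1) with e | e
          · rw [e]; exact hy
          · exact b4 t a (by omega))
        have v10 : v1 ≠ 0 := by
          intro e
          obtain ⟨a, b, c, a1, a2, a3, a4, a5, A, B, D⟩ := H.pyz.mx 0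
          have h1 := ay b (by omega) (by omega) B
          have h2 := ay c (by omega) (by omega) D
          exact b4 b (by omega) (by omega) B
        have := H.h4 w u v1 (k - 1) s1 q1 (Or.inl ⟨by omega, b3, zk, fun t a b => by
          rcases eq_or_ne t (k - 1) with e | e
          · rw [e]; exact hy
          · exact b4 t a (by omega), fun t a b => az2 t (by omega) (by omega)⟩)
          (fun t a b => nX t (by omega) (by omega)) (by omega) (by omega)
        omega
  · have hw1 : w = k - 1 := by omega
    have hw2 : w2 ≠ -1 := by
      intro e
      obtain ⟨a, b, c, a1, a2, a3, a4, a5, A, B, D⟩ := H.pyz.mz (-1)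
      have := az b (by omega) (by omega) B
      have := az c (by omega) (by omega) D
      exact az2 b (by omega) (by omega) B
    have s2 : Seg Y Z w2 v := Or.inr ⟨by omega, zw2, yv, fun t a b => az2 t (by omega) (by omega),
      fun t a b => nY t (by omega) (by omega)⟩
    have q2 : ∀ t, w2 ≤ t → t ≤ v → ¬ X t := fun t a b => nX t (by omega) (by omega)
    by_cases hx : X (n - 1)
    · have xm : X (-1) := by have := (sx (n - 1)).2 hx; rwa [sub_sub_cancel_left] at this
      have := H.h4 (-1) (-1) w2 v (Or.inl ⟨le_rfl, xm, zm, fun t a b => by omega,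
        fun t a b => by omega⟩) (fun t a b c => by
          obtain rfl : t = -1 := by omega
          exact nt _ xm c zm) s2 q2 (by omega) (by omega)
      omega
    · have z0 : Z 0 := cm.resolve_right hx
      rcases le_or_gt 2 w2 with h | h
      · have := H.h4 0 0 w2 v (Or.inl ⟨le_rfl, x0, z0, fun t a b => by omega,
          fun t a b => by omega⟩) (fun t a b c => by
          obtain rfl : t = 0 := by omega
          exact nt _ x0 c z0) s2 q2 (by omega) (by omega)
        omega
      · obtain ⟨u1, b1, b2, b3, b4⟩ := lastLE (s := n - 2) xu (by omega)
        have xn : X n := by have := (ax1 0).2 x0; rwa [zero_add] at this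
        have b5 : ∀ t, u1 < t → t ≤ n - 1 → ¬ X t := fun t a b => by
          rcases eq_or_ne t (n - 1) with e | e
          · rw [e]; exact hx
          · exact b4 t a (by omega)
        have g := H.pxz.gx u1 n (by omega) b3 xn (fun t a b => b5 t a (by omega))
        have u1u : u < u1 := by
          by_contra hh
          obtain ⟨a, b, c, a1, a2, a3, a4, a5, A, B, D⟩ := H.pxz.mx 0
          have h2 := ax b (by omega) (by omega) B
          exact b5 c (by omega) (by omega) D
        have := H.h4 (u1 - n) (-1) w2 v (Or.inl ⟨by omega, (sx _).2 b3, zm, fun t a b c =>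
            b5 (t + n) (by omega) (by omega) ((ax1 _).2 c),
          fun t a b c => nZ (t + n) (by omega) (by omega) ((az1 _).2 c)⟩)
          (fun t a b c => nY2 (t + n) (by omega) (by omega) ((ay1 _).2 c)) s2 q2
          (by omega) (by omega)
        omega

theorem plusB {n : ℤ} {X Y Z : ℤ → Prop} (H : TB n X Y Z)
    {w u k w2 v : ℤ} (S : Std n X Z w u)
    (P : PF n Y Z w k w2 v) : False := by
  obtain ⟨w4, wu, un, we, uo, z1, zw, x0, xu, az, ax, cm⟩ := S
  obtain ⟨kw, w2m, wv, vk, par, zk, zw2, yk, yv, cm2, ay, az2⟩ := P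
  have sx := per_sub H.pxz.px
  have sy := per_sub H.pyz.px
  have ax1 := H.pxz.px
  have ay1 := H.pyz.px
  have xn : X n := by have := (ax1 0).2 x0; rwa [zero_add] at this
  obtain ⟨k2, w3, u3, ⟨l1, l2, T⟩ | ⟨l1, l2, T⟩⟩ :=
    (pair_struct H.pxy).norm (by omega) ax1 ay1 1 (-1)
  · obtain ⟨t1, t2, t3, t4, t5, t6, t7, t8, t9, t10, t11⟩ := T
    have e1 := ay (k2 - 1) (by omega) (by omega) t5
    have e2 := ax k2 (by omega) (by omega) t7
    have e3 := t10 n (by omega) (by omega) xn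
    have e4 := t9 (v + n) (by omega) (by omega) ((ay1 _).2 yv)
    omega
  · obtain ⟨t1, t2, t3, t4, t5, t6, t7, t8, t9, t10, t11⟩ := T
    have e1 := ay (k2 + 1) (by omega) (by omega) t5
    have e2 : k2 = -1 ∨ k2 = 0 := by
      by_contra hh
      have e2 := ax k2 (by omega) (by omega) t7
      omega
    have e3 := t10 (u - n) (by omega) (by omega) ((sx _).2 xu)
    have e4 := t9 (k - n) (by omega) (by omega) ((sy _).2 yk)
    omega

/-- facts in the negatively oriented case -/
structure NF (n : ℤ) (Y Z : ℤ → Prop) (w k w2 v : ℤ) : Prop where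
  km : -1 ≤ k
  kw : k + 1 ≤ w
  w2n : w2 ≤ n - 1
  vw : v < w2
  kv : k + 4 ≤ v
  zk : Z (k + 1)
  yk : Y k
  yv : Y v
  cm : Z k ∨ Y (k + 1)
  ay : ∀ i, k < i → i < k + n → Y i → i ≤ v
  alt : w2 ≤ w ∨ w = k + 1

theorem minus_facts {n : ℤ} {X Y Z : ℤ → Prop} (pxz : Pair n X Z) (pyz : Pair n Y Z)
    (nt : ∀ i, X i → Y i → Z i → False) {w u k wk uk : ℤ} (S : Std n X Z w u)
    (k0 : -1 ≤ k) (kn : k < -1 + n) (T : SN n Y Z k wk uk) :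
    NF n Y Z w k (wk + n) (uk + n) := by
  obtain ⟨w4, wu, un, we, uo, z1, zw, x0, xu, az, ax, cm⟩ := S
  obtain ⟨t1, t2, t3, t4, t5, t6, t7, t8, t9, t10, t11⟩ := T
  have sy := per_sub pyz.px
  have sz := per_sub pxz.pz
  have ay1 := pyz.px
  have hay : ∀ i, k < i → i < k + n → Y i → i ≤ uk + n := fun i a b c => by
    have := t10 (i - n) (by omega) (by omega) ((sy _).2 c)
    omega
  have hv : k + 4 ≤ uk + n := by
    obtain ⟨a, b, c, a1, a2, a3, a4, a5, A, B, D⟩ := pyz.mx k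
    have := hay c (by omega) (by omega) D
    omega
  have hk : k ≠ n - 2 := by
    intro e
    rcases t11 with h | h
    · have := az k (by omega) (by omega) h
      omega
    · rcases cm with h' | h'
      · have := t9 0 (by omega) (by omega) h'
        omega
      · refine nt (n - 1) h' ?_ z1
        convert h using 1; omega
  have hw : k + 1 ≤ w := by
    have := az (k + 1) (by omega) (by omega) t5
    omega
  have e1 := t9 (n - 1 - n) (by omega) (by omega) ((sz _).2 z1)
  have e2 := t9 (w - n) (by omega) (by omega) ((sz _).2 zw)
  exact ⟨k0, hw, by omega, by omega, hv, t5, t7, (ay1 _).2 t8, t11, hay, by omega⟩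

theorem minusA {n : ℤ} {X Y Z : ℤ → Prop} (H : TA n X Y Z)
    (nt : ∀ i, X i → Y i → Z i → False) {w u k w2 v : ℤ} (S : Std n X Z w u)
    (P : NF n Y Z w k w2 v) : False := by
  obtain ⟨w4, wu, un, we, uo, z1, zw, x0, xu, az, ax, cm⟩ := S
  obtain ⟨km, kw, w2n, vw, kv, zk, yk, yv, cm2, ay, alt⟩ := P
  have hev := H.pxz.ev
  have sx := per_sub H.pxz.px
  have sz := per_sub H.pxz.pz
  have ay1 := H.pyz.px
  have ax1 := H.pxz.px
  have az1 := H.pxz.pz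
  have zm : Z (-1) := by have := (sz (n - 1)).2 z1; rwa [sub_sub_cancel_left] at this
  have nX : ∀ i, 0 < i → i < u → ¬ X i := fun i a b c => by
    have := ax i (by omega) (by omega) c; omega
  have nZ : ∀ i, w < i → i < n - 1 → ¬ Z i := fun i a b c => by
    have := az i (by omega) (by omega) c; omega
  have nY : ∀ i, v < i → i < k + n → ¬ Y i := fun i a b c => by
    have := ay i (by omega) (by omega) c; omega
  rcases alt with hw | hw
  · have s1 : Seg X Z w u := Or.inr ⟨by omega, zw, xu, fun t a b => nZ t (by omega) (by omega),
      fun t a b => nX t (by omega) (by omega)⟩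
    have q1 : ∀ t, w ≤ t → t ≤ u → ¬ Y t := fun t a b => nY t (by omega) (by omega)
    have key : ∀ p, (p = k ∨ p = k + 1) → Y p → Z p → False := by
      intro p hp yp zp
      have := H.h4 w u p p s1 q1 (Or.inl ⟨le_rfl, yp, zp, fun t a b => by omega,
          fun t a b => by omega⟩) (fun t a b c => by
            obtain rfl : t = p := by omega
            exact nt t c yp zp) (by omega) (by omega)
      omega
    rcases cm2 with h | h
    · exact key k (Or.inl rfl) yk h
    · exact key (k + 1) (Or.inr rfl) h zk
  · have := H.h3 0 k (Or.inl ⟨by omega, x0, yk, fun t a b => nX t (by omega) (by omega),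
      fun t a b c => nY (t + n) (by omega) (by omega) ((ay1 _).2 c)⟩) (by omega)
    omega

theorem minusB {n : ℤ} {X Y Z : ℤ → Prop} (H : TB n X Y Z)
    (nt : ∀ i, X i → Y i → Z i → False) {w u k w2 v : ℤ} (S : Std n X Z w u)
    (P : NF n Y Z w k w2 v) : False := by
  obtain ⟨w4, wu, un, we, uo, z1, zw, x0, xu, az, ax, cm⟩ := S
  obtain ⟨km, kw, w2n, vw, kv, zk, yk, yv, cm2, ay, alt⟩ := P
  have sx := per_sub H.pxz.px
  have sy := per_sub H.pyz.px
  have sz := per_sub H.pxz.pz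
  have ay1 := H.pyz.px
  have ax1 := H.pxz.px
  have az1 := H.pxz.pz
  have zm : Z (-1) := by have := (sz (n - 1)).2 z1; rwa [sub_sub_cancel_left] at this
  have xn : X n := by have := (ax1 0).2 x0; rwa [zero_add] at this
  obtain ⟨k2, w3, u3, ⟨l1, l2, T⟩ | ⟨l1, l2, T⟩⟩ :=
    (pair_struct H.pxy).norm (by omega) ax1 ay1 (k + 1) (k - 1)
  · obtain ⟨t1, t2, t3, t4, t5, t6, t7, t8, t9, t10, t11⟩ := T
    have e1 : k2 - 1 = k ∨ k2 - 1 ≤ v := by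
      by_contra hh
      have := ay (k2 - 1) (by omega) (by omega) t5
      omega
    rcases alt with hw | hw
    · have e2 := ax k2 (by omega) (by omega) t7
      obtain rfl : k2 = 0 := by omega
      obtain rfl : k = -1 := by omega
      rcases t11 with h | h
      · exact nt 0 x0 h zk
      · exact nt (-1) (by simpa using h) yk zm
    · have e2 := ax k2 (by omega) (by omega) t7
      have e3 := t10 n (by omega) (by omega) xn
      have e4 := t9 (k + n) (by omega) (by omega) ((ay1 _).2 yk)
      omega
  · obtain ⟨t1, t2, t3, t4, t5, t6, t7, t8, t9, t10, t11⟩ := T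
    have e1 : k2 + 1 = k ∨ k2 + 1 ≤ v := by
      by_contra hh
      have := ay (k2 + 1) (by omega) (by omega) t5
      omega
    rcases alt with hw | hw
    · have e2 : k2 < 0 ∨ k2 = 0 := by
        by_contra hh
        have e2 := ax k2 (by omega) (by omega) t7
        omega
      have e3 := t10 (u - n) (by omega) (by omega) ((sx _).2 xu)
      have e4 := t9 (v - n) (by omega) (by omega) ((sy _).2 yv)
      omega
    · have e2 := ax k2 (by omega) (by omega) t7
      have e0 := t10 0 (by omega) (by omega) x0
      have e3 := t10 u (by omega) (by omega) xu
      have e4 := t9 k (by omega) (by omega) yk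
      obtain rfl : k2 = u := by omega
      have e5 : v ≤ k2 + 1 := by
        by_contra hh
        have := t9 (v - n) (by omega) (by omega) ((sy _).2 yv)
        omega
      have a1 : ∃ a, (a = k ∨ a = k + 1) ∧ Y a ∧ Z a := by
        rcases cm2 with h | h
        · exact ⟨k, Or.inl rfl, yk, h⟩
        · exact ⟨k + 1, Or.inr rfl, h, zk⟩
      have c1 : ∃ c, (c = k2 ∨ c = k2 + 1) ∧ X c ∧ Y c := by
        rcases t11 with h | h
        · exact ⟨k2, Or.inl rfl, xu, h⟩
        · exact ⟨k2 + 1, Or.inr rfl, h, t5⟩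
      have b1 : ∃ b, (b = n ∨ b = n - 1) ∧ X b ∧ Z b := by
        rcases cm with h | h
        · refine ⟨n, Or.inl rfl, xn, ?_⟩
          have := (az1 0).2 h; rwa [zero_add] at this
        · exact ⟨n - 1, Or.inr rfl, h, z1⟩
      obtain ⟨a, ha, a2, a3⟩ := a1
      obtain ⟨b, hb, b2, b3⟩ := b1
      obtain ⟨c, hc, c2, c3⟩ := c1
      have := H.h5 a b c a2 a3 (fun h => nt a h a2 a3) b2 b3 (fun h => nt b b2 h b3) c2 c3
        (fun h => nt c c2 c3 h) (by omega)
      omega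

theorem tripleA {n : ℤ} {X Y Z : ℤ → Prop} (H : TA n X Y Z) : ∃ i, X i ∧ Y i ∧ Z i := by
  by_contra hc
  push Not at hc
  have key : ∀ X Y Z : ℤ → Prop, TA n X Y Z → (∀ i, X i → Y i → Z i → False) →
      Struct n X Z → False := by
    intro X Y Z H nt hs
    have hn := H.pxz.n6
    obtain ⟨w, u, S⟩ := hs.std H.pxz
    obtain ⟨k, wk, uk, ⟨l1, l2, T⟩ | ⟨l1, l2, T⟩⟩ :=
      (pair_struct H.pyz).norm (by omega) H.pyz.px H.pyz.pz 0 (-1)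
    · exact plusA H nt S (plus_facts H.pxz H.pyz nt S l1 (by omega) T)
    · exact minusA H nt S (minus_facts H.pxz H.pyz nt S l1 l2 T)
  obtain ⟨K, h | h⟩ := pair_struct H.pxz
  · exact key _ _ _ (H.shift K) (fun i a b c => hc _ a b c) h
  · exact key _ _ _ (H.neg K) (fun i a b c => hc _ a b c) h

theorem tripleB {n : ℤ} {X Y Z : ℤ → Prop} (H : TB n X Y Z) : ∃ i, X i ∧ Y i ∧ Z i := by
  by_contra hc
  push Not at hc
  have key : ∀ X Y Z : ℤ → Prop, TB n X Y Z → (∀ i, X i → Y i → Z i → False) →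
      Struct n X Z → False := by
    intro X Y Z H nt hs
    have hn := H.pxz.n6
    obtain ⟨w, u, S⟩ := hs.std H.pxz
    obtain ⟨k, wk, uk, ⟨l1, l2, T⟩ | ⟨l1, l2, T⟩⟩ :=
      (pair_struct H.pyz).norm (by omega) H.pyz.px H.pyz.pz 0 (-1)
    · exact plusB H S (plus_facts H.pxz H.pyz nt S l1 (by omega) T)
    · exact minusB H nt S (minus_facts H.pxz H.pyz nt S l1 l2 T)
  obtain ⟨K, h | h⟩ := pair_struct H.pxz
  · exact key _ _ _ (H.shift K) (fun i a b c => hc _ a b c) h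
  · exact key _ _ _ (H.neg K) (fun i a b c => hc _ a b c) h

theorem pair_common {n : ℤ} {X Z : ℤ → Prop} (h : Pair n X Z) : ∃ i, X i ∧ Z i := by
  obtain ⟨K, hs | hs⟩ := pair_struct h
  all_goals
    obtain ⟨w, u, h1, h2, h3, h4, h5, h6, h7, h8, h9, h10, h11⟩ := hs
    rcases h11 with h | h
    · exact ⟨_, h7, h⟩
    · exact ⟨_, h, h5⟩

/-- cyclic parametrisation of a hole -/
structure Par (G : SimpleGraph V) (C : Set V) (n : ℤ) (f : ℤ → V) : Prop where
  n4 : 4 ≤ n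
  inj : ∀ i j, f i = f j ↔ n ∣ i - j
  ran : ∀ v, v ∈ C ↔ ∃ i, f i = v
  adj : ∀ i j, G.Adj (f i) (f j) ↔ n ∣ i - j - 1 ∨ n ∣ j - i - 1

theorem seq_refl {f : ℤ → V} {G : SimpleGraph V} (had : ∀ i, G.Adj (f i) (f (i + 1)))
    (hne : ∀ i, f i ≠ f (i + 2))
    (hoth : ∀ i j, G.Adj (f i) (f j) → f j = f (i + 1) ∨ f j = f (i - 1))
    (i j : ℤ) (hij : i ≠ j) (h : f i = f j) (h1 : f (i + 1) ≠ f (j + 1)) : False := by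
  have step : ∀ i j, f i = f j → f (i + 1) = f (j - 1) → f (i + 1 + 1) = f (j - 1 - 1) := by
    intro i j a b
    have h2 : G.Adj (f (j - 1)) (f (i + 1 + 1)) := by rw [← b]; exact had _
    rcases hoth _ _ h2 with h | h
    · exfalso
      have : f (i + 1 + 1) = f i := by rw [h, sub_add_cancel, a]
      exact hne i (by rw [← this]; congr 1; ring)
    · exact h
  have b0 : ∀ i j, f i = f j → f (i + 1) ≠ f (j + 1) → f (i + 1) = f (j - 1) := by
    intro i j a b
    have h2 : G.Adj (f j) (f (i + 1)) := by rw [← a]; exact had _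
    exact (hoth _ _ h2).resolve_left b
  have all : ∀ i j, f i = f j → f (i + 1) = f (j - 1) → ∀ t : ℕ, f (i + t) = f (j - t) ∧
      f (i + t + 1) = f (j - t - 1) := by
    intro i j a b t
    induction t with
    | zero => simpa using ⟨a, b⟩
    | succ t ih =>
      have := step _ _ ih.1 ih.2
      push_cast
      rw [← add_assoc, ← sub_sub]
      exact ⟨ih.2, this⟩
  have fin : ∀ i j, i < j → f i = f j → f (i + 1) = f (j - 1) → False := by
    intro i j c a b
    obtain ⟨d, hd⟩ := Int.eq_ofNat_of_zero_le (show 0 ≤ (j - i) / 2 by omega)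
    have := all i j a b d
    rcases Int.emod_two_eq_zero_or_one (j - i) with e | e
    · obtain ⟨d', rfl⟩ : ∃ d', d = d' + 1 := ⟨d - 1, by omega⟩
      have := all i j a b d'
      have e1 : j - ((d' : ℕ) : ℤ) = i + d' + 2 := by push_cast at hd; omega
      rw [e1] at this
      exact hne _ this.1
    · have e1 : j - (d : ℤ) = i + d + 1 := by omega
      rw [e1] at this
      exact (had _).ne this.1
  have hb := b0 i j h h1
  rcases lt_or_gt_of_ne hij with c | c
  · exact fin i j c h hb
  · refine fin j i c h.symm (b0 j i h.symm h1.symm)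

theorem exists_par [Fintype V] {G : SimpleGraph V} {C : Set V} (h : IsHole G C) :
    ∃ f, Par G C C.ncard f := by
  classical
  obtain ⟨hcon, hdeg, hcard⟩ := h
  have H : ∀ v u, v ∈ C → u ∈ C → G.Adj v u → ∃ w, w ∈ C ∧ G.Adj v w ∧ w ≠ u ∧
      ∀ x ∈ C, G.Adj v x → x = u ∨ x = w := by
    intro v u hv hu a
    obtain ⟨p, q, hpq, e⟩ := Set.ncard_eq_two.1 (hdeg v hv)
    have mem : ∀ x, (x ∈ C ∧ G.Adj v x) ↔ (x = p ∨ x = q) := fun x => by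
      have := congrArg (x ∈ ·) e
      simpa using this
    have hp := (mem p).2 (Or.inl rfl)
    have hq := (mem q).2 (Or.inr rfl)
    rcases (mem u).1 ⟨hu, a⟩ with rfl | rfl
    · exact ⟨q, hq.1, hq.2, hpq.symm, fun x h1 h2 => (mem x).1 ⟨h1, h2⟩⟩
    · exact ⟨p, hp.1, hp.2, hpq, fun x h1 h2 => ((mem x).1 ⟨h1, h2⟩).symm⟩
  choose! o o1 o2 o3 o4 using H
  have oo : ∀ v u, v ∈ C → u ∈ C → G.Adj v u → o v (o v u) = u := by
    intro v u hv hu a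
    have b1 := o1 v u hv hu a
    have b2 := o2 v u hv hu a
    rcases o4 v u hv hu a _ (o1 v (o v u) hv b1 b2) (o2 v (o v u) hv b1 b2) with h | h
    · exact h
    · exact absurd h (o3 v (o v u) hv b1 b2)
  let D := {p : V × V // p.1 ∈ C ∧ p.2 ∈ C ∧ G.Adj p.1 p.2}
  let σ : Equiv.Perm D :=
    { toFun := fun p => ⟨(p.1.2, o p.1.2 p.1.1), p.2.2.1, o1 _ _ p.2.2.1 p.2.1 p.2.2.2.symm,
        o2 _ _ p.2.2.1 p.2.1 p.2.2.2.symm⟩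
      invFun := fun p => ⟨(o p.1.1 p.1.2, p.1.1), o1 _ _ p.2.1 p.2.2.1 p.2.2.2, p.2.1,
        (o2 _ _ p.2.1 p.2.2.1 p.2.2.2).symm⟩
      left_inv := fun p => Subtype.ext (Prod.ext (oo _ _ p.2.2.1 p.2.1 p.2.2.2.symm) rfl)
      right_inv := fun p => Subtype.ext (Prod.ext rfl (oo _ _ p.2.1 p.2.2.1 p.2.2.2)) }
  obtain ⟨v0, hv0⟩ : C.Nonempty := by
    rw [← Set.ncard_pos]; omega
  obtain ⟨v1, hv1⟩ : {w ∈ C | G.Adj v0 w}.Nonempty := by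
    rw [← Set.ncard_pos, hdeg v0 hv0]; omega
  let d0 : D := ⟨(v0, v1), hv0, hv1.1, hv1.2⟩
  let f : ℤ → V := fun i => ((σ ^ i) d0).1.1
  have fs : ∀ i : ℤ, σ ((σ ^ i) d0) = (σ ^ (i + 1)) d0 := fun i => by
    rw [add_comm, zpow_add, zpow_one]; rfl
  have f1 : ∀ i, f (i + 1) = ((σ ^ i) d0).1.2 := fun i => by
    change ((σ ^ (i + 1)) d0).1.1 = _
    rw [← fs]; rfl
  have fC : ∀ i, f i ∈ C := fun i => ((σ ^ i) d0).2.1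
  have had : ∀ i, G.Adj (f i) (f (i + 1)) := fun i => by
    rw [f1]; exact ((σ ^ i) d0).2.2.2
  have f2 : ∀ i, f (i + 2) = o (f (i + 1)) (f i) := fun i => by
    rw [show i + 2 = (i + 1) + 1 by ring, f1, ← fs, f1]; rfl
  have hne : ∀ i, f i ≠ f (i + 2) := fun i => by
    rw [f2]; exact (o3 _ _ (fC _) (fC _) (had i).symm).symm
  have hoth' : ∀ i, ∀ x ∈ C, G.Adj (f i) x → x = f (i + 1) ∨ x = f (i - 1) := by
    intro i x hx a
    have h1 := had (i - 1)
    have h2 := f2 (i - 1)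
    rw [sub_add_cancel] at h1
    rw [show i - 1 + 2 = i + 1 by ring, sub_add_cancel] at h2
    rw [h2]
    exact (o4 _ _ (fC i) (fC (i - 1)) h1.symm x hx a).symm
  have hper : ∀ i j, f i = f j → (σ ^ i) d0 = (σ ^ j) d0 := by
    intro i j e
    by_cases hij : i = j
    · rw [hij]
    refine Subtype.ext (Prod.ext e ?_)
    rw [← f1, ← f1]
    by_contra hh
    exact seq_refl had hne (fun i j a => hoth' i _ (fC j) a) i j hij e hh
  have hran : ∀ v ∈ C, ∃ i, f i = v := by
    intro v hv
    obtain ⟨p⟩ := hcon.preconnected ⟨v0, hv0⟩ ⟨v, hv⟩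
    have : ∀ (a b : C), (G.induce C).Walk a b → (∃ i, f i = a.1) → ∃ i, f i = b.1 := by
      intro a b p
      induction p with
      | nil => exact id
      | @cons a b c hadj _ ih =>
        rintro ⟨i, hi⟩
        refine ih ?_
        have : G.Adj (f i) b.1 := by rw [hi]; exact hadj
        rcases hoth' i _ b.2 this with h | h
        · exact ⟨_, h.symm⟩
        · exact ⟨_, h.symm⟩
    exact this _ _ p ⟨0, rfl⟩
  let m := Function.minimalPeriod σ d0
  have hm0 : 0 < m := Function.minimalPeriod_pos_of_mem_periodicPts
    (σ.injective.mem_periodicPts d0)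
  have hinj : ∀ i j, f i = f j ↔ (m : ℤ) ∣ i - j := by
    intro i j
    have : (m : ℤ) ∣ i - j ↔ (σ ^ i) d0 = (σ ^ j) d0 := by
      have e := MulAction.zpow_smul_eq_iff_minimalPeriod_dvd (a := σ) (b := d0) (n := i - j)
      change _ ↔ (m : ℤ) ∣ i - j at e
      rw [← e]
      rw [sub_eq_neg_add, zpow_add, zpow_neg, mul_smul, inv_smul_eq_iff]
      rfl
    rw [this]
    exact ⟨hper i j, fun e => congrArg (fun d : D => d.1.1) e⟩
  have hcm : C.ncard = m := by
    have e : C = (fun i : ℕ => f i) '' (Finset.range m : Set ℕ) := by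
      ext v
      constructor
      · intro hv
        obtain ⟨i, hi⟩ := hran v hv
        refine ⟨(i % m).toNat, ?_, ?_⟩
        · have := Int.emod_lt_of_pos i (show (0:ℤ) < m by omega)
          have := Int.emod_nonneg i (show (m:ℤ) ≠ 0 by omega)
          simp; omega
        · have := Int.emod_nonneg i (show (m:ℤ) ≠ 0 by omega)
          dsimp only
          rw [Int.toNat_of_nonneg this, ← hi, hinj]
          have := Int.emod_add_mul_ediv i m
          exact ⟨-(i / m), by linarith⟩
      · rintro ⟨i, _, rfl⟩
        exact fC _
    rw [e, Set.InjOn.ncard_image, Set.ncard_coe_finset, Finset.card_range]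
    intro i hi j hj hij
    dsimp only at hij
    rw [hinj] at hij
    simp at hi hj
    have := Int.eq_zero_of_abs_lt_dvd hij (by rw [abs_lt]; omega)
    omega
  refine ⟨f, by omega, ?_, fun v => ⟨hran v, ?_⟩, ?_⟩
  · rw [hcm]; exact hinj
  · rintro ⟨i, rfl⟩; exact fC i
  · intro i j
    rw [hcm]
    have e1 : (m : ℤ) ∣ j - i - 1 ↔ f j = f (i + 1) := by rw [hinj]; congr! 1; ring
    have e2 : (m : ℤ) ∣ i - j - 1 ↔ f i = f (j + 1) := by rw [hinj]; congr! 1; ring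
    rw [e1, e2]
    constructor
    · intro a
      rcases hoth' i _ (fC j) a with h | h
      · exact Or.inr h
      · left; rw [hinj] at h ⊢
        have := (dvd_neg).2 h
        rwa [show i - (j + 1) = -(j - (i - 1)) by ring]
    · rintro (h | h)
      · rw [h]; exact (had j).symm
      · rw [h]; exact had i

/-- `S` induces a path with ends `a, b` and `p` edges -/
inductive PathOn (G : SimpleGraph V) : Set V → V → V → ℕ → Prop
  | single (x : V) : PathOn G {x} x x 0
  | cons {S : Set V} {a b : V} {p : ℕ} (x : V) (h : PathOn G S a b p) (hx : x ∉ S)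
      (ha : ∀ s ∈ S, G.Adj x s ↔ s = a) : PathOn G (insert x S) x b (p + 1)

theorem PathOn.left {G : SimpleGraph V} {S : Set V} {a b : V} {p : ℕ} (h : PathOn G S a b p) :
    a ∈ S := by
  cases h <;> simp

theorem PathOn.right {G : SimpleGraph V} {S : Set V} {a b : V} {p : ℕ} (h : PathOn G S a b p) :
    b ∈ S := by
  induction h with
  | single x => simp
  | cons x h hx ha ih => exact Set.mem_insert_of_mem _ ih

theorem PathOn.concat {G : SimpleGraph V} {S T : Set V} {a b c d : V} {p r : ℕ}
    (h : PathOn G S a b p) (h' : PathOn G T c d r)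
    (hcr : ∀ s ∈ S, ∀ t ∈ T, s ≠ t ∧ (G.Adj s t ↔ s = b ∧ t = c)) :
    PathOn G (S ∪ T) a d (p + r + 1) := by
  induction h with
  | single x =>
    have : PathOn G (insert x T) x d (r + 1) := PathOn.cons x h'
      (fun hx => (hcr x rfl x hx).1 rfl) (fun t ht => by rw [(hcr x rfl t ht).2]; simp)
    rw [Set.insert_eq] at this
    simpa using this
  | @cons S a b p x h hx ha ih =>
    have ih' := ih (fun s hs t ht => hcr s (Set.mem_insert_of_mem _ hs) t ht)
    rw [Set.insert_union, show p + 1 + r + 1 = (p + r + 1) + 1 by omega]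
    refine PathOn.cons x ih' ?_ ?_
    · rintro (h1 | h1)
      · exact hx h1
      · exact (hcr x (Set.mem_insert _ _) x h1).1 rfl
    · rintro s (h1 | h1)
      · exact ha s h1
      · rw [(hcr x (Set.mem_insert _ _) s h1).2]
        constructor
        · rintro ⟨rfl, _⟩; exact absurd h.right hx
        · rintro rfl
          exact absurd rfl (hcr s (Set.mem_insert_of_mem _ h.left) s h1).1

theorem PathOn.rev {G : SimpleGraph V} {S : Set V} {a b : V} {p : ℕ} (h : PathOn G S a b p) :
    PathOn G S b a p := by
  induction h with
  | single x => exact PathOn.single x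
  | @cons S a b p x h hx ha ih =>
    have := ih.concat (PathOn.single (G := G) x) (by
      rintro s hs t rfl
      refine ⟨fun e => hx (e ▸ hs), ?_⟩
      rw [G.adj_comm, ha s hs]; simp)
    rw [Set.union_singleton] at this
    simpa using this

theorem PathOn.conn {G : SimpleGraph V} {S : Set V} {a b : V} {p : ℕ} (h : PathOn G S a b p) :
    (G.induce S).Connected := by
  induction h with
  | single x =>
    have : Nonempty ({x} : Set V) := ⟨⟨x, rfl⟩⟩
    exact ⟨fun u v => by rw [Subsingleton.elim u v]⟩
  | @cons S a b p x h hx ha ih =>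
    have h1 := SimpleGraph.induce_pair_connected_of_adj ((ha a h.left).2 rfl)
    have := SimpleGraph.induce_union_connected h1.preconnected ih.preconnected ⟨a, by simp, h.left⟩
    have e : ({x, a} : Set V) ∪ S = insert x S := by
      rw [Set.insert_union, Set.singleton_union, Set.insert_eq_of_mem h.left]
    rw [e] at this
    exact this

theorem PathOn.deg [Finite V] {G : SimpleGraph V} {S : Set V} {a b : V} {p : ℕ}
    (h : PathOn G S a b p) : S.ncard = p + 1 ∧ ∀ v ∈ S, ∀ e1 e2 : ℕ,
      (v = a → e1 = 1) → (v ≠ a → e1 = 0) → (v = b → e2 = 1) → (v ≠ b → e2 = 0) →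
      {w ∈ S | G.Adj v w}.ncard + e1 + e2 = 2 := by
  induction h with
  | single x =>
    refine ⟨by simp, ?_⟩
    rintro v rfl e1 e2 h1 _ h2 _
    have : {w ∈ ({v} : Set V) | G.Adj v w} = ∅ := by
      ext w; simp; rintro rfl; exact G.irrefl
    rw [this, Set.ncard_empty, h1 rfl, h2 rfl]
  | @cons S a b p x h hx ha ih =>
    refine ⟨by rw [Set.ncard_insert_of_notMem hx, ih.1], ?_⟩
    rintro v hv e1 e2 h1 h1' h2 h2'
    rcases hv with rfl | hv
    · have : {w ∈ insert v S | G.Adj v w} = {a} := by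
        ext w
        simp only [Set.mem_insert_iff, Set.mem_ofPred_eq, Set.mem_singleton_iff]
        constructor
        · rintro ⟨rfl | hw, h⟩
          · exact absurd h G.irrefl
          · exact (ha w hw).1 h
        · rintro rfl
          exact ⟨Or.inr h.left, (ha w h.left).2 rfl⟩
      rw [this, Set.ncard_singleton, h1 rfl, h2' (fun e => hx (e ▸ h.right))]
    · have hvx : v ≠ x := fun e => hx (e ▸ hv)
      have e10 := h1' hvx
      by_cases hva : v = a
      · subst hva
        have : {w ∈ insert x S | G.Adj v w} = insert x {w ∈ S | G.Adj v w} := by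
          ext w
          simp only [Set.mem_insert_iff, Set.mem_ofPred_eq]
          constructor
          · rintro ⟨rfl | hw, h⟩
            · exact Or.inl rfl
            · exact Or.inr ⟨hw, h⟩
          · rintro (rfl | hw)
            · exact ⟨Or.inl rfl, ((ha v hv).2 rfl).symm⟩
            · exact ⟨Or.inr hw.1, hw.2⟩
        rw [this, Set.ncard_insert_of_notMem (fun hh => hx hh.1)]
        have := ih.2 v hv 1 e2 (fun _ => rfl) (fun h => absurd rfl h) h2 h2'
        omega
      · have : {w ∈ insert x S | G.Adj v w} = {w ∈ S | G.Adj v w} := by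
          ext w
          simp only [Set.mem_insert_iff, Set.mem_ofPred_eq]
          constructor
          · rintro ⟨rfl | hw, h⟩
            · exact absurd ((ha v hv).1 h.symm) hva
            · exact ⟨hw, h⟩
          · rintro hw
            exact ⟨Or.inr hw.1, hw.2⟩
        rw [this]
        have := ih.2 v hv 0 e2 (fun h => absurd h hva) (fun h => rfl) h2 h2'
        omega

theorem PathOn.close [Finite V] {G : SimpleGraph V} {S : Set V} {a b : V} {p : ℕ}
    (h : PathOn G S a b p) (hp : 2 ≤ p) (x : V) (hx : x ∉ S)
    (ha : ∀ s ∈ S, G.Adj x s ↔ s = a ∨ s = b) :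
    IsHole G (insert x S) ∧ (insert x S).ncard = p + 2 := by
  have hab : a ≠ b := by
    cases h with
    | single x => omega
    | cons _ h' hx' _ => rintro rfl; exact hx' h'.right
  obtain ⟨d1, d2⟩ := h.deg
  have hc : (insert x S).ncard = p + 2 := by rw [Set.ncard_insert_of_notMem hx, d1]
  refine ⟨⟨?_, ?_, by omega⟩, hc⟩
  · have h1 := SimpleGraph.induce_pair_connected_of_adj ((ha a h.left).2 (Or.inl rfl))
    have := SimpleGraph.induce_union_connected h1.preconnected h.conn.preconnected
      ⟨a, by simp, h.left⟩
    have e : ({x, a} : Set V) ∪ S = insert x S := by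
      rw [Set.insert_union, Set.singleton_union, Set.insert_eq_of_mem h.left]
    rw [e] at this
    exact this
  · rintro v (rfl | hv)
    · have : {w ∈ insert v S | G.Adj v w} = {a, b} := by
        ext w
        simp only [Set.mem_insert_iff, Set.mem_ofPred_eq, Set.mem_singleton_iff]
        constructor
        · rintro ⟨rfl | hw, h⟩
          · exact absurd h G.irrefl
          · exact (ha w hw).1 h
        · rintro hw
          have hws : w ∈ S := by
            rcases hw with rfl | rfl
            exacts [h.left, h.right]
          exact ⟨Or.inr hws, (ha w hws).2 hw⟩
      rw [this, Set.ncard_pair hab]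
    · have hvx : v ≠ x := fun e => hx (e ▸ hv)
      by_cases hva : v = a ∨ v = b
      · have : {w ∈ insert x S | G.Adj v w} = insert x {w ∈ S | G.Adj v w} := by
          ext w
          simp only [Set.mem_insert_iff, Set.mem_ofPred_eq]
          constructor
          · rintro ⟨rfl | hw, h⟩
            · exact Or.inl rfl
            · exact Or.inr ⟨hw, h⟩
          · rintro (rfl | hw)
            · exact ⟨Or.inl rfl, ((ha v hv).2 hva).symm⟩
            · exact ⟨Or.inr hw.1, hw.2⟩
        rw [this, Set.ncard_insert_of_notMem (fun hh => hx hh.1)]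
        rcases hva with rfl | rfl
        · have := d2 v hv 1 0 (fun _ => rfl) (fun h => absurd rfl h) (fun h => absurd h hab)
            (fun _ => rfl)
          omega
        · have := d2 v hv 0 1 (fun h => absurd h.symm hab) (fun _ => rfl) (fun _ => rfl)
            (fun h => absurd rfl h)
          omega
      · push Not at hva
        have : {w ∈ insert x S | G.Adj v w} = {w ∈ S | G.Adj v w} := by
          ext w
          simp only [Set.mem_insert_iff, Set.mem_ofPred_eq]
          constructor
          · rintro ⟨rfl | hw, h⟩
            · rcases (ha v hv).1 h.symm with h | h
              exacts [absurd h hva.1, absurd h hva.2]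
            · exact ⟨hw, h⟩
          · rintro hw
            exact ⟨Or.inr hw.1, hw.2⟩
        rw [this]
        have := d2 v hv 0 0 (fun h => absurd h hva.1) (fun _ => rfl) (fun h => absurd h hva.2)
          (fun _ => rfl)
        omega

theorem four_hole [Finite V] {G : SimpleGraph V} (h4 : ∀ C : Set V, IsHole G C → C.ncard ≠ 4)
    {a b c d : V} (ab : G.Adj a b) (bc : G.Adj b c) (cd : G.Adj c d) (da : G.Adj d a)
    (ac : ¬ G.Adj a c) (hac : a ≠ c) (bd : ¬ G.Adj b d) (hbd : b ≠ d) : False := by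
  have h1 : PathOn G {c, d} c d 1 := by
    refine PathOn.cons c (PathOn.single d) (by simpa using cd.ne) ?_
    rintro s rfl; simpa using cd
  have h2 : PathOn G {b, c, d} b d 2 := by
    refine PathOn.cons b h1 (by simp [bc.ne, hbd]) ?_
    rintro s (rfl | rfl)
    · simpa using bc
    · simp [bd, cd.ne']
  have := h2.close le_rfl a (by simp [ab.ne, hac, da.ne']) (by
    rintro s (rfl | rfl | rfl)
    · simpa using ab
    · simp [ac, bc.ne', cd.ne]
    · simpa using da.symm)
  exact h4 _ this.1 this.2

theorem short [Finite V] {G : SimpleGraph V} {C : Set V} (hC : IsShortestEvenHole G C)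
    {S : Set V} {a b : V} {p : ℕ} (h : PathOn G S a b p) (hp : 2 ≤ p) (hev : p % 2 = 0)
    (x : V) (hx : x ∉ S) (ha : ∀ s ∈ S, G.Adj x s ↔ s = a ∨ s = b) : C.ncard ≤ p + 2 := by
  obtain ⟨h1, h2⟩ := h.close hp x hx ha
  have := hC.2 _ ⟨h1, by rw [h2, Nat.even_iff]; omega⟩
  omega

theorem dvd_small {n d : ℤ} (h : n ∣ d) (h1 : -n < d) (h2 : d < n) : d = 0 :=
  Int.eq_zero_of_abs_lt_dvd h (by rw [abs_lt]; omega)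

theorem Par.path {G : SimpleGraph V} {C : Set V} {n : ℤ} {f : ℤ → V} (P : Par G C n f)
    (p : ℕ) : ∀ i : ℤ, (p : ℤ) + 2 ≤ n → PathOn G (f '' Set.Icc i (i + p)) (f i) (f (i + p)) p := by
  induction p with
  | zero => intro i _; simpa using PathOn.single (f i)
  | succ p ih =>
    intro i hi
    push_cast at hi
    have := ih (i + 1) (by omega)
    have e : f '' Set.Icc i (i + ((p + 1 : ℕ) : ℤ)) = insert (f i) (f '' Set.Icc (i + 1) (i + 1 + p)) := by
      rw [← Set.image_insert_eq]; congr 1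
      ext t; simp; omega
    rw [e, show i + ((p + 1 : ℕ) : ℤ) = i + 1 + p by push_cast; ring]
    refine PathOn.cons _ this ?_ ?_
    · rintro ⟨t, ⟨h1, h2⟩, h⟩
      rw [P.inj] at h
      have := dvd_small h (by omega) (by omega)
      omega
    · rintro _ ⟨t, ⟨h1, h2⟩, rfl⟩
      rw [P.adj, P.inj]
      constructor
      · rintro (h | h)
        · have := dvd_small h (by omega) (by omega)
          omega
        · rwa [show t - (i + 1) = t - i - 1 by ring]
      · intro h; right; rwa [show t - i - 1 = t - (i + 1) by ring]

def Nb (G : SimpleGraph V) (f : ℤ → V) (x : V) : ℤ → Prop := fun i => G.Adj x (f i)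

theorem Par.per {G : SimpleGraph V} {C : Set V} {n : ℤ} {f : ℤ → V} (P : Par G C n f)
    (x : V) (i : ℤ) : Nb G f x (i + n) ↔ Nb G f x i := by
  have : f (i + n) = f i := by rw [P.inj]; simp
  unfold Nb; rw [this]

theorem Par.mem {G : SimpleGraph V} {C : Set V} {n : ℤ} {f : ℤ → V} (P : Par G C n f)
    (i : ℤ) : f i ∈ C := (P.ran _).2 ⟨i, rfl⟩

theorem Par.sub {G : SimpleGraph V} {C : Set V} {n : ℤ} {f : ℤ → V} (P : Par G C n f)
    (I : Set ℤ) {s : V} (h : s ∈ f '' I) : s ∈ C := by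
  obtain ⟨i, _, rfl⟩ := h; exact P.mem i

theorem Par.cross {G : SimpleGraph V} {C : Set V} {n : ℤ} {f : ℤ → V} (P : Par G C n f)
    {i j k l : ℤ} (h : (j + 2 ≤ k ∧ l + 2 ≤ i + n) ∨ (l + 2 ≤ i ∧ j + 2 ≤ k + n)) :
    ∀ s ∈ f '' Set.Icc i j, ∀ t ∈ f '' Set.Icc k l, s ≠ t ∧ ¬ G.Adj s t := by
  rintro _ ⟨a, ⟨a1, a2⟩, rfl⟩ _ ⟨b, ⟨b1, b2⟩, rfl⟩
  rw [Ne, P.inj, P.adj]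
  refine ⟨fun h => ?_, ?_⟩
  · have := dvd_small h (by omega) (by omega); omega
  · rintro (h | h)
    · have := dvd_small h (by omega) (by omega); omega
    · have := dvd_small h (by omega) (by omega); omega

theorem Par.seg {G : SimpleGraph V} {C : Set V} {n : ℤ} {f : ℤ → V} (P : Par G C n f)
    {x z : V} {i j : ℤ} (h : Seg (Nb G f x) (Nb G f z) i j) (hn : j - i + 2 ≤ n) :
    ∃ (p : ℕ) (a b : V), (p : ℤ) = j - i ∧ PathOn G (f '' Set.Icc i j) a b p ∧
      (∀ s ∈ f '' Set.Icc i j, G.Adj x s ↔ s = a) ∧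
      (∀ s ∈ f '' Set.Icc i j, G.Adj z s ↔ s = b) := by
  have key : ∀ x z, SegD (Nb G f x) (Nb G f z) i j →
    ∃ (p : ℕ) (a b : V), (p : ℤ) = j - i ∧ PathOn G (f '' Set.Icc i j) a b p ∧
      (∀ s ∈ f '' Set.Icc i j, G.Adj x s ↔ s = a) ∧
      (∀ s ∈ f '' Set.Icc i j, G.Adj z s ↔ s = b) := by
    rintro x z ⟨h1, h2, h3, h4, h5⟩
    obtain ⟨p, hp⟩ := Int.eq_ofNat_of_zero_le (show 0 ≤ j - i by omega)
    have := P.path p i (by omega)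
    rw [show i + (p : ℤ) = j by omega] at this
    refine ⟨p, _, _, hp.symm, this, ?_, ?_⟩
    · rintro _ ⟨t, ⟨t1, t2⟩, rfl⟩
      constructor
      · intro h
        rcases eq_or_lt_of_le t1 with e | e
        · rw [e]
        · exact absurd h (h4 t e t2)
      · intro e; rw [e]; exact h2
    · rintro _ ⟨t, ⟨t1, t2⟩, rfl⟩
      constructor
      · intro h
        rcases eq_or_lt_of_le t2 with e | e
        · rw [e]
        · exact absurd h (h5 t t1 e)
      · intro e; rw [e]; exact h3
  rcases h with h | h
  · exact key x z h
  · obtain ⟨p, a, b, h1, h2, h3, h4⟩ := key z x h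
    exact ⟨p, b, a, h1, h2.rev, h4, h3⟩

theorem Par.H1 [Finite V] {G : SimpleGraph V} {C : Set V} {n : ℤ} {f : ℤ → V} (P : Par G C n f)
    (hC : IsShortestEvenHole G C) (hn : n = C.ncard) {x : V} (hx : x ∉ C) {i j : ℤ} (hij : i + 2 ≤ j)
    (hjn : j - i + 2 ≤ n) (xi : Nb G f x i) (xj : Nb G f x j)
    (hno : ∀ k, i < k → k < j → ¬ Nb G f x k) (he : (j - i) % 2 = 0) : n ≤ j - i + 2 := by
  obtain ⟨p, hp⟩ := Int.eq_ofNat_of_zero_le (show 0 ≤ j - i by omega)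
  have := P.path p i (by omega)
  rw [show i + (p : ℤ) = j by omega] at this
  have := short hC this (by omega) (by omega) x (fun h => hx (P.sub _ h)) (by
    rintro _ ⟨t, ⟨t1, t2⟩, rfl⟩
    constructor
    · intro h
      by_contra hh
      push Not at hh
      refine hno t ?_ ?_ h
      · exact lt_of_le_of_ne t1 (fun e => hh.1 (by rw [e]))
      · exact lt_of_le_of_ne t2 (fun e => hh.2 (by rw [e]))
    · rintro (e | e) <;> rw [e] <;> assumption)
  omega

theorem Par.H2 [Finite V] {G : SimpleGraph V} {C : Set V} {n : ℤ} {f : ℤ → V} (P : Par G C n f)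
    (hC : IsShortestEvenHole G C) (hn : n = C.ncard) {x z : V} (hx : x ∉ C) (hz : z ∉ C)
    (hxz : x ≠ z) (hna : ¬ G.Adj x z) (i j k l : ℤ) (h1 : Seg (Nb G f x) (Nb G f z) i j)
    (h2 : Seg (Nb G f x) (Nb G f z) k l) (h3 : j + 2 ≤ k) (h4 : l + 2 ≤ i + n)
    (h5 : ((j - i) + (l - k)) % 2 = 0) : n ≤ (j - i) + (l - k) + 4 := by
  have hij : i ≤ j := by rcases h1 with h | h <;> exact h.1
  have hkl : k ≤ l := by rcases h2 with h | h <;> exact h.1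
  obtain ⟨p, a, b, p1, p2, p3, p4⟩ := P.seg h1 (by omega)
  obtain ⟨r, c, d, r1, r2, r3, r4⟩ := P.seg h2 (by omega)
  have cr := P.cross (Or.inl ⟨h3, h4⟩)
  have zS : ∀ s ∈ f '' Set.Icc i j, s ≠ z := fun s hs e => hz (e ▸ P.sub _ hs)
  have zT : ∀ s ∈ f '' Set.Icc k l, s ≠ z := fun s hs e => hz (e ▸ P.sub _ hs)
  have xS : x ∉ f '' Set.Icc i j := fun hs => hx (P.sub _ hs)
  have xT : x ∉ f '' Set.Icc k l := fun hs => hx (P.sub _ hs)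
  have aS := p2.left
  have cT := r2.left
  generalize f '' Set.Icc i j = S at *
  generalize f '' Set.Icc k l = T at *
  have q1 := p2.concat (PathOn.single z) (by
    rintro s hs t rfl
    refine ⟨zS s hs, ?_⟩
    rw [G.adj_comm, p4 s hs]; simp)
  have q2 := q1.concat r2.rev (by
    rintro s (hs | rfl) t ht
    · have := cr s hs t ht
      have := zS s hs
      tauto
    · refine ⟨(zT t ht).symm, ?_⟩
      rw [r4 t ht]; simp)
  have := short hC q2 (by omega) (by omega) x (by
    rintro ((h | h) | h)
    · exact xS h
    · exact hxz h
    · exact xT h) (by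
    rintro s ((h | rfl) | h)
    · have := cr s h c cT
      rw [p3 s h]; tauto
    · have := zS a aS
      have := zT c cT
      constructor
      · intro h; exact absurd h hna
      · rintro (h | h)
        · exact absurd h.symm (zS a aS)
        · exact absurd h.symm (zT c cT)
    · have := cr a aS s h
      rw [r3 s h]
      constructor
      · exact Or.inr
      · rintro (e | e)
        · exact absurd e.symm this.1
        · exact e)
  omega

theorem Par.H3 [Finite V] {G : SimpleGraph V} {C : Set V} {n : ℤ} {f : ℤ → V} (P : Par G C n f)
    (hC : IsShortestEvenHole G C) (hn : n = C.ncard) {x z : V} (hx : x ∉ C) (hz : z ∉ C)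
    (hna : G.Adj x z) (i j : ℤ) (h1 : Seg (Nb G f x) (Nb G f z) i j)
    (h5 : (j - i) % 2 = 1) : n ≤ j - i + 3 := by
  have hij : i ≤ j := by rcases h1 with h | h <;> exact h.1
  by_contra hcon
  obtain ⟨p, a, b, p1, p2, p3, p4⟩ := P.seg h1 (by omega)
  have zS : ∀ s ∈ f '' Set.Icc i j, s ≠ z := fun s hs e => hz (e ▸ P.sub _ hs)
  have xS : x ∉ f '' Set.Icc i j := fun hs => hx (P.sub _ hs)
  have aS := p2.left
  generalize f '' Set.Icc i j = S at *
  have q1 := p2.concat (PathOn.single z) (by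
    rintro s hs t rfl
    refine ⟨zS s hs, ?_⟩
    rw [G.adj_comm, p4 s hs]; simp)
  have := short hC q1 (by omega) (by omega) x (by
    rintro (h | h)
    · exact xS h
    · exact hna.ne h) (by
    rintro s (h | rfl)
    · have := zS s h
      rw [p3 s h]; tauto
    · simpa using hna)
  omega

theorem Par.H4 [Finite V] {G : SimpleGraph V} {C : Set V} {n : ℤ} {f : ℤ → V} (P : Par G C n f)
    (hC : IsShortestEvenHole G C) (hn : n = C.ncard) {x y z : V} (hx : x ∉ C) (hy : y ∉ C)
    (hz : z ∉ C) (hxy : G.Adj x y)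
    (hxz : x ≠ z) (hyz : y ≠ z) (nxz : ¬ G.Adj x z) (nyz : ¬ G.Adj y z) (i j k l : ℤ)
    (h1 : Seg (Nb G f x) (Nb G f z) i j) (h1' : ∀ t, i ≤ t → t ≤ j → ¬ Nb G f y t)
    (h2 : Seg (Nb G f y) (Nb G f z) k l) (h2' : ∀ t, k ≤ t → t ≤ l → ¬ Nb G f x t)
    (h3 : (j + 2 ≤ k ∧ l + 2 ≤ i + n) ∨ (l + 2 ≤ i ∧ j + 2 ≤ k + n))
    (h5 : ((j - i) + (l - k)) % 2 = 1) : n ≤ (j - i) + (l - k) + 5 := by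
  have hij : i ≤ j := by rcases h1 with h | h <;> exact h.1
  have hkl : k ≤ l := by rcases h2 with h | h <;> exact h.1
  obtain ⟨p, a, b, p1, p2, p3, p4⟩ := P.seg h1 (by omega)
  obtain ⟨r, c, d, r1, r2, r3, r4⟩ := P.seg h2 (by omega)
  have cr := P.cross h3
  have out : ∀ v, v ∉ C → (∀ s ∈ f '' Set.Icc i j, s ≠ v) ∧ (∀ s ∈ f '' Set.Icc k l, s ≠ v) :=
    fun v hv => ⟨fun s hs e => hv (e ▸ P.sub _ hs), fun s hs e => hv (e ▸ P.sub _ hs)⟩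
  obtain ⟨xS, xT⟩ := out x hx
  obtain ⟨yS, yT⟩ := out y hy
  obtain ⟨zS, zT⟩ := out z hz
  have yS' : ∀ s ∈ f '' Set.Icc i j, ¬ G.Adj y s := by
    rintro _ ⟨t, ⟨t1, t2⟩, rfl⟩; exact h1' t t1 t2
  have xT' : ∀ s ∈ f '' Set.Icc k l, ¬ G.Adj x s := by
    rintro _ ⟨t, ⟨t1, t2⟩, rfl⟩; exact h2' t t1 t2
  have bS := p2.right
  have dT := r2.right
  generalize f '' Set.Icc i j = S at *
  generalize f '' Set.Icc k l = T at *
  have q1 := p2.rev.concat (PathOn.single x) (by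
    rintro s hs t rfl
    refine ⟨xS s hs, ?_⟩
    rw [G.adj_comm, p3 s hs]; simp)
  have q2 := q1.concat (PathOn.single y) (by
    rintro s (hs | rfl) t rfl
    · refine ⟨yS s hs, ?_⟩
      rw [G.adj_comm]
      have := yS' s hs
      have := xS s hs
      tauto
    · exact ⟨hxy.ne, by simpa using hxy⟩)
  have q3 := q2.concat r2 (by
    rintro s ((hs | rfl) | rfl) t ht
    · have := cr s hs t ht
      have := yS s hs
      tauto
    · have := xT' t ht
      have := xT t ht
      have := hxy.ne
      exact ⟨this.symm ∘ fun e => by simp_all, by tauto⟩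
    · refine ⟨(yT t ht).symm, ?_⟩
      rw [r3 t ht]; simp)
  have := short hC q3 (by omega) (by omega) z (by
    rintro (((h | h) | h) | h)
    · exact zS _ h rfl
    · exact hxz h.symm
    · exact hyz h.symm
    · exact zT _ h rfl) (by
    rintro s (((h | rfl) | rfl) | h)
    · have := cr s h d dT
      rw [p4 s h]; tauto
    · rw [G.adj_comm]
      have := xS b bS
      have := xT d dT
      constructor
      · intro h; exact absurd h nxz
      · rintro (h | h)
        · exact absurd h.symm (xS b bS)
        · exact absurd h.symm (xT d dT)
    · rw [G.adj_comm]
      constructor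
      · intro h; exact absurd h nyz
      · rintro (h | h)
        · exact absurd h.symm (yS b bS)
        · exact absurd h.symm (yT d dT)
    · have := cr b bS s h
      rw [r4 s h]
      constructor
      · exact Or.inr
      · rintro (e | e)
        · exact absurd e.symm this.1
        · exact e)
  omega

theorem six_hole [Finite V] {G : SimpleGraph V} {C : Set V} (hC : IsShortestEvenHole G C)
    {x y z a b c : V} (hxy : x ≠ y) (hxz : x ≠ z) (hyz : y ≠ z) (nxy : ¬ G.Adj x y)
    (nxz : ¬ G.Adj x z) (nyz : ¬ G.Adj y z) (hab : a ≠ b) (hac : a ≠ c) (hbc : b ≠ c)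
    (nab : ¬ G.Adj a b) (nac : ¬ G.Adj a c) (nbc : ¬ G.Adj b c)
    (ya : G.Adj y a) (za : G.Adj z a) (xa : ¬ G.Adj x a)
    (xb : G.Adj x b) (zb : G.Adj z b) (yb : ¬ G.Adj y b)
    (xc : G.Adj x c) (yc : G.Adj y c) (zc : ¬ G.Adj z c) (ax : a ≠ x) (bey : b ≠ y) (cz : c ≠ z) :
    C.ncard ≤ 6 := by
  have h1 : PathOn G {x, b} x b 1 := by
    refine PathOn.cons x (PathOn.single b) (by simpa using xb.ne) ?_
    rintro s rfl; simpa using xb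
  have h2 : PathOn G {c, x, b} c b 2 := by
    refine PathOn.cons c h1 (by simp [xc.ne', hbc.symm]) ?_
    rintro s (rfl | rfl)
    · simpa using xc.symm
    · rw [G.adj_comm]; simp [nbc, xb.ne']
  have h3 : PathOn G {y, c, x, b} y b 3 := by
    refine PathOn.cons y h2 (by simp [yc.ne, bey.symm, hxy.symm]) ?_
    rintro s (rfl | rfl | rfl)
    · simpa using yc
    · rw [G.adj_comm]; simp [nxy, xc.ne]
    · simp [yb, hbc]
  have h4 : PathOn G {a, y, c, x, b} a b 4 := by
    refine PathOn.cons a h3 (by simp [ya.ne', hac, ax, hab]) ?_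
    rintro s (rfl | rfl | rfl | rfl)
    · simpa using ya.symm
    · simp [nac, yc.ne']
    · rw [G.adj_comm]; simp [xa, hxy]
    · simp [nab, bey]
  have := short hC h4 (by omega) (by omega) z (by simp [za.ne, hyz.symm, cz.symm, hxz.symm, zb.ne])
    (by
    rintro s (rfl | rfl | rfl | rfl | rfl)
    · simpa using za
    · rw [G.adj_comm]; simp [nyz, ya.ne, bey.symm]
    · simp [zc, hac.symm, hbc.symm]
    · rw [G.adj_comm]; simp [nxz, xb.ne, ax.symm]
    · simpa using zb)
  omega

/-- standing assumptions -/
structure Ctx (G : SimpleGraph V) (C : Set V) (n : ℤ) (f : ℤ → V) : Prop where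
  h4 : ∀ C : Set V, IsHole G C → C.ncard ≠ 4
  hC : IsShortestEvenHole G C
  hn : n = C.ncard
  P : Par G C n f

theorem Ctx.n6 {G : SimpleGraph V} {C : Set V} {n : ℤ} {f : ℤ → V} (K : Ctx G C n f) :
    6 ≤ n ∧ n % 2 = 0 := by
  have h1 := K.h4 C K.hC.1.1
  have h2 := K.hC.1.2
  have h3 := K.P.n4
  have h4 := K.hn
  rw [Nat.even_iff] at h2
  omega

theorem Ctx.maj {G : SimpleGraph V} {C : Set V} {n : ℤ} {f : ℤ → V} (K : Ctx G C n f)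
    {x : V} (hx : IsMajor G C x) : Maj n (Nb G f x) := by
  intro s
  have hn := K.n6.1
  obtain ⟨_, a, b, c, ha, hb, hc, xa, xb, xc, ab, bc, ac, nab, nbc, nac⟩ := hx
  have pick : ∀ v ∈ C, ∃ i, s ≤ i ∧ i < s + n ∧ f i = v := by
    intro v hv
    obtain ⟨i, hi⟩ := (K.P.ran v).1 hv
    obtain ⟨m, m1, m2⟩ := norm_exists (show 0 < n by omega) s i
    exact ⟨_, m1, m2, by rw [← hi, K.P.inj]; simp⟩
  have far : ∀ i j, s ≤ i → i < s + n → s ≤ j → j < s + n → f i ≠ f j → ¬ G.Adj (f i) (f j) →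
      (i + 2 ≤ j ∧ j + 2 ≤ i + n) ∨ (j + 2 ≤ i ∧ i + 2 ≤ j + n) := by
    intro i j i1 i2 j1 j2 h1 h2
    rw [K.P.adj] at h2
    push Not at h2
    have e1 : i ≠ j := fun e => h1 (by rw [e])
    have e2 : i - j - 1 ≠ 0 := fun e => h2.1 (by rw [e]; simp)
    have e3 : j - i - 1 ≠ 0 := fun e => h2.2 (by rw [e]; simp)
    have e4 : i - j - 1 ≠ -n := fun e => h2.1 (by rw [e]; simp)
    have e5 : j - i - 1 ≠ -n := fun e => h2.2 (by rw [e]; simp)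
    omega
  obtain ⟨i, i1, i2, rfl⟩ := pick a ha
  obtain ⟨j, j1, j2, rfl⟩ := pick b hb
  obtain ⟨k, k1, k2, rfl⟩ := pick c hc
  have f1 := far i j i1 i2 j1 j2 ab nab
  have f2 := far j k j1 j2 k1 k2 bc nbc
  have f3 := far i k i1 i2 k1 k2 ac nac
  rcases lt_or_ge i j with o1 | o1 <;> rcases lt_or_ge j k with o2 | o2 <;>
    rcases lt_or_ge i k with o3 | o3
  · exact ⟨i, j, k, by omega, by omega, by omega, by omega, by omega, xa, xb, xc⟩
  · omega
  · exact ⟨i, k, j, by omega, by omega, by omega, by omega, by omega, xa, xc, xb⟩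
  · exact ⟨k, i, j, by omega, by omega, by omega, by omega, by omega, xc, xa, xb⟩
  · exact ⟨j, i, k, by omega, by omega, by omega, by omega, by omega, xb, xa, xc⟩
  · exact ⟨j, k, i, by omega, by omega, by omega, by omega, by omega, xb, xc, xa⟩
  · omega
  · exact ⟨k, j, i, by omega, by omega, by omega, by omega, by omega, xc, xb, xa⟩

theorem Ctx.gap [Finite V] {G : SimpleGraph V} {C : Set V} {n : ℤ} {f : ℤ → V} (K : Ctx G C n f)
    {x : V} (hx : IsMajor G C x) : Gap (Nb G f x) := by
  intro i j hij xi xj hno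
  obtain ⟨a, b, c, a1, a2, a3, a4, a5, A, B, D⟩ := K.maj hx (i + 1)
  have : j ≤ a := by
    by_contra hh
    exact hno a (by omega) (by omega) A
  by_contra hh
  have := K.P.H1 K.hC K.hn hx.1 (show i + 2 ≤ j by omega) (by omega) xi xj hno (by omega)
  omega

theorem Ctx.pair [Finite V] {G : SimpleGraph V} {C : Set V} {n : ℤ} {f : ℤ → V} (K : Ctx G C n f)
    {x z : V} (hx : IsMajor G C x) (hz : IsMajor G C z) (hxz : x ≠ z) (na : ¬ G.Adj x z) :
    Pair n (Nb G f x) (Nb G f z) :=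
  ⟨K.n6.1, K.n6.2, K.P.per x, K.P.per z, K.maj hx, K.maj hz, K.gap hx, K.gap hz,
    fun i j k l a b c d e => K.P.H2 K.hC K.hn hx.1 hz.1 hxz na i j k l a b c d e⟩

theorem Ctx.T2 [Finite V] {G : SimpleGraph V} {C : Set V} {n : ℤ} {f : ℤ → V} (K : Ctx G C n f)
    {x z : V} (hx : IsMajor G C x) (hz : IsMajor G C z) (hxz : x ≠ z) (na : ¬ G.Adj x z) :
    ∃ v ∈ C, G.Adj x v ∧ G.Adj z v := by
  obtain ⟨i, h1, h2⟩ := pair_common (K.pair hx hz hxz na)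
  exact ⟨f i, K.P.mem i, h1, h2⟩

theorem Ctx.T3 [Finite V] {G : SimpleGraph V} {C : Set V} {n : ℤ} {f : ℤ → V} (K : Ctx G C n f)
    {x y z : V} (hx : IsMajor G C x) (hy : IsMajor G C y) (hz : IsMajor G C z) (hxz : x ≠ z)
    (hyz : y ≠ z) (hxy : x ≠ y) (nxz : ¬ G.Adj x z) (nyz : ¬ G.Adj y z) :
    ∃ v ∈ C, G.Adj x v ∧ G.Adj y v ∧ G.Adj z v := by
  have hn := K.hn
  have : ∃ i, Nb G f x i ∧ Nb G f y i ∧ Nb G f z i := by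
    by_cases a : G.Adj x y
    · exact tripleA ⟨K.pair hx hz hxz nxz, K.pair hy hz hyz nyz,
        fun i j h e => K.P.H3 K.hC K.hn hx.1 hy.1 a i j h e,
        fun i j k l a1 a2 a3 a4 a5 a6 => K.P.H4 K.hC K.hn hx.1 hy.1 hz.1 a hxz hyz nxz nyz
          i j k l a1 a2 a3 a4 a5 a6⟩
    · refine tripleB ⟨K.pair hx hz hxz nxz, K.pair hy hz hyz nyz, K.pair hx hy hxy a, ?_⟩
      intro i j k y1 z1 x1 x2 z2 y2 x3 y3 z3 h
      have cr : ∀ i j, (i + 2 ≤ j ∧ j + 2 ≤ i + n) ∨ (j + 2 ≤ i ∧ i + 2 ≤ j + n) →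
          f i ≠ f j ∧ ¬ G.Adj (f i) (f j) := by
        intro i j h
        exact K.P.cross (i := i) (j := i) (k := j) (l := j) h _ ⟨i, by simp, rfl⟩ _ ⟨j, by simp, rfl⟩
      obtain ⟨e1, e1'⟩ := cr i j (by omega)
      obtain ⟨e2, e2'⟩ := cr i k (by omega)
      obtain ⟨e3, e3'⟩ := cr j k (by omega)
      have := six_hole K.hC hxy hxz hyz a nxz nyz e1 e2 e3 e1' e2' e3' y1 z1 x1 x2 z2 y2 x3 y3 z3
        (fun e => hx.1 (e ▸ K.P.mem i)) (fun e => hy.1 (e ▸ K.P.mem j))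
        (fun e => hz.1 (e ▸ K.P.mem k))
      omega
  obtain ⟨i, h1, h2, h3⟩ := this
  exact ⟨f i, K.P.mem i, h1, h2, h3⟩

theorem Ctx.T3' [Finite V] {G : SimpleGraph V} {C : Set V} {n : ℤ} {f : ℤ → V} (K : Ctx G C n f)
    {x y z : V} (hx : IsMajor G C x) (hy : IsMajor G C y) (hz : IsMajor G C z)
    (hxy : x ≠ y) (nxy : ¬ G.Adj x y) :
    ∃ v ∈ C, G.Adj x v ∧ G.Adj y v ∧ G.Adj z v := by
  obtain ⟨v, hv, v1, v2⟩ := K.T2 hx hy hxy nxy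
  by_cases e1 : z = x
  · exact ⟨v, hv, v1, v2, e1 ▸ v1⟩
  by_cases e2 : z = y
  · exact ⟨v, hv, v1, v2, e2 ▸ v2⟩
  by_cases zx : G.Adj z x
  · by_cases zy : G.Adj z y
    · by_cases zv : G.Adj z v
      · exact ⟨v, hv, v1, v2, zv⟩
      · exact (four_hole K.h4 v1 v2.symm zy.symm zx nxy hxy (fun h => zv h.symm)
          (fun e => hz.1 (e ▸ hv))).elim
    · obtain ⟨v, a, b, c, d⟩ := K.T3 hx hz hy hxy e2 (Ne.symm e1) nxy zy
      exact ⟨v, a, b, d, c⟩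
  · by_cases zy : G.Adj z y
    · obtain ⟨v, a, b, c, d⟩ := K.T3 hy hz hx hxy.symm e1 (Ne.symm e2) (fun h => nxy h.symm) zx
      exact ⟨v, a, d, b, c⟩
    · obtain ⟨v, a, b, c, d⟩ := K.T3 hx hy hz (Ne.symm e1) (Ne.symm e2) hxy (fun h => zx h.symm)
        (fun h => zy h.symm)
      exact ⟨v, a, b, c, d⟩

theorem Ctx.noTri {G : SimpleGraph V} {C : Set V} {n : ℤ} {f : ℤ → V} (K : Ctx G C n f)
    {a b c : V} (ha : a ∈ C) (hb : b ∈ C) (hc : c ∈ C) (ab : G.Adj a b) (bc : G.Adj b c)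
    (ca : G.Adj c a) : False := by
  have hn := K.n6.1
  obtain ⟨i, rfl⟩ := (K.P.ran a).1 ha
  obtain ⟨j, rfl⟩ := (K.P.ran b).1 hb
  obtain ⟨k, rfl⟩ := (K.P.ran c).1 hc
  have key : ∀ i j, G.Adj (f i) (f j) → ∃ e, (e = 1 ∨ e = -1) ∧ n ∣ i - j - e := by
    intro i j h
    rcases (K.P.adj i j).1 h with h | h
    · exact ⟨1, Or.inl rfl, h⟩
    · refine ⟨-1, Or.inr rfl, ?_⟩
      have := (dvd_neg).2 h
      rwa [show i - j - -1 = -(j - i - 1) by ring]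
  obtain ⟨e1, h1, d1⟩ := key i j ab
  obtain ⟨e2, h2, d2⟩ := key j k bc
  obtain ⟨e3, h3, d3⟩ := key k i ca
  have := dvd_add (dvd_add d1 d2) d3
  have := dvd_small this (by omega) (by omega)
  omega

theorem Ctx.cliq [Finite V] {G : SimpleGraph V} {C : Set V} {n : ℤ} {f : ℤ → V} (K : Ctx G C n f)
    {x y a b : V} (hxy : x ≠ y) (nxy : ¬ G.Adj x y) (xa : G.Adj x a) (ya : G.Adj y a)
    (xb : G.Adj x b) (yb : G.Adj y b) (hab : a ≠ b) : G.Adj a b := by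
  by_contra h
  exact four_hole K.h4 xa ya.symm yb xb.symm nxy hxy h hab

theorem Ctx.main [Finite V] {G : SimpleGraph V} {C : Set V} {n : ℤ} {f : ℤ → V} (K : Ctx G C n f)
    (hnc : ∀ v ∈ C, ∃ m, IsMajor G C m ∧ ¬ G.Adj m v) {x y : V} (hx : IsMajor G C x)
    (hy : IsMajor G C y) (hxy : x ≠ y) : G.Adj x y := by
  by_contra nxy
  obtain ⟨c, cC, xc, yc⟩ := K.T2 hx hy hxy nxy
  obtain ⟨z, hz, zc⟩ := hnc c cC
  obtain ⟨c', cC', xc', yc', zc'⟩ := K.T3' hx hy hz hxy nxy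
  have ne1 : c ≠ c' := by rintro rfl; exact zc zc'
  have cc' := K.cliq hxy nxy xc yc xc' yc' ne1
  obtain ⟨w, hw, wc'⟩ := hnc c' cC'
  obtain ⟨c2, cC2, xc2, yc2, wc2⟩ := K.T3' hx hy hw hxy nxy
  have ne2 : c2 ≠ c' := by rintro rfl; exact wc' wc2
  have ec : c2 = c := by
    by_contra ne3
    exact K.noTri cC cC' cC2 cc' (K.cliq hxy nxy xc' yc' xc2 yc2 ne2.symm)
      (K.cliq hxy nxy xc2 yc2 xc yc ne3)
  subst ec
  have zw : z ≠ w := by rintro rfl; exact wc' zc'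
  have nzw : ¬ G.Adj z w := fun h =>
    four_hole K.h4 zc' cc'.symm wc2.symm h.symm zc (fun e => hz.1 (e ▸ cC)) (fun h => wc' h.symm)
      (fun e => hw.1 (e ▸ cC'))
  -- a major vertex adjacent to both would see every common neighbour
  have both : ∀ t d, IsMajor G C t → d ∈ C → G.Adj x d → G.Adj y d → ¬ G.Adj t d →
      G.Adj t x → G.Adj t y → False := fun t d ht hd a1 a2 a3 a4 a5 =>
    four_hole K.h4 a1 a2.symm a5.symm a4 nxy hxy (fun h => a3 h.symm) (fun e => ht.1 (e ▸ hd))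
  have core : ∀ x y, IsMajor G C x → IsMajor G C y → G.Adj x c2 → G.Adj x c' → G.Adj y c2 →
      G.Adj y c' → x ≠ z → y ≠ w → x ≠ w → ¬ G.Adj x z → ¬ G.Adj y w → False := by
    intro x y hx hy xc xc' yc yc' xz yw xw nxz nyw
    obtain ⟨e, eC, ze, we, xe⟩ := K.T3' hz hw hx zw nzw
    obtain ⟨g, gC, zg, wg, yg⟩ := K.T3' hz hw hy zw nzw
    have e1 : e ≠ c2 := by rintro rfl; exact zc ze
    have e2 : e ≠ c' := by rintro rfl; exact wc' we
    have g1 : g ≠ c2 := by rintro rfl; exact zc zg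
    have g2 : g ≠ c' := by rintro rfl; exact wc' wg
    have a1 := K.cliq xz nxz xe ze xc' zc' e2
    have a2 := K.cliq yw nyw yg wg yc wc2 g1
    by_cases eg : e = g
    · subst eg
      exact K.noTri eC cC' cC2 a1 cc'.symm a2.symm
    · have a3 := K.cliq zw nzw ze we zg wg eg
      exact four_hole K.h4 a1 cc'.symm a2.symm a3.symm
        (fun h => K.noTri eC cC' cC2 a1 cc'.symm h.symm) e1
        (fun h => K.noTri cC2 cC' gC cc' h a2) g2.symm
  have xz : x ≠ z := by rintro rfl; exact zc xc
  have yz : y ≠ z := by rintro rfl; exact zc yc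
  have xw : x ≠ w := by rintro rfl; exact wc' xc'
  have yw : y ≠ w := by rintro rfl; exact wc' yc'
  -- both missing the same vertex is impossible
  have same : ∀ x, IsMajor G C x → G.Adj x c2 → G.Adj x c' → x ≠ z → x ≠ w → ¬ G.Adj x z →
      ¬ G.Adj x w → False := fun x hx xc xc' xz xw nxz nxw =>
    core x x hx hx xc xc' xc xc' xz xw xw nxz nxw
  by_cases h1 : G.Adj x z
  · have h2 : ¬ G.Adj y z := fun h => both z c2 hz cC xc yc zc h1.symm h.symm
    have h3 : G.Adj y w := by
      by_contra h; exact same y hy yc yc' yz yw h2 h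
    have h4 : ¬ G.Adj x w := fun h => both w c' hw cC' xc' yc' wc' h.symm h3.symm
    exact core y x hy hx yc yc' xc xc' yz xw yw h2 h4
  · have h3 : G.Adj x w := by
      by_contra h; exact same x hx xc xc' xz xw h1 h
    have h4 : ¬ G.Adj y w := fun h => both w c' hw cC' xc' yc' wc' h3.symm h.symm
    exact core x y hx hy xc xc' yc yc' xz yw xw h1 h4

theorem del_adj {G : SimpleGraph V} {S : Set V} {a b : V} :
    (delVerts G S).Adj a b ↔ a ∉ S ∧ b ∉ S ∧ G.Adj a b := by
  unfold delVerts
  rw [SimpleGraph.fromRel_adj]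
  constructor
  · rintro ⟨_, h | h⟩
    · exact h
    · exact ⟨h.2.1, h.1, h.2.2.symm⟩
  · intro h
    exact ⟨h.2.2.ne, Or.inl h⟩

theorem hole_congr {G H : SimpleGraph V} {C : Set V} (e : ∀ a ∈ C, ∀ b ∈ C, G.Adj a b ↔ H.Adj a b)
    (h : IsHole G C) : IsHole H C := by
  obtain ⟨h1, h2, h3⟩ := h
  refine ⟨?_, ?_, h3⟩
  · have : G.induce C = H.induce C := by
      ext a b; exact e a.1 a.2 b.1 b.2
    rwa [← this]
  · intro v hv
    rw [← h2 v hv]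
    congr 1
    ext w
    simp only [Set.mem_ofPred_eq]
    constructor
    · rintro ⟨a, b⟩; exact ⟨a, (e v hv w a).2 b⟩
    · rintro ⟨a, b⟩; exact ⟨a, (e v hv w a).1 b⟩

theorem del_congr {G : SimpleGraph V} {S C : Set V} (hS : ∀ v ∈ C, v ∉ S) :
    ∀ a ∈ C, ∀ b ∈ C, G.Adj a b ↔ (delVerts G S).Adj a b := fun a ha b hb => by
  rw [del_adj]; exact ⟨fun h => ⟨hS a ha, hS b hb, h⟩, fun h => h.2.2⟩

theorem del_avoid {G : SimpleGraph V} {S C : Set V} (h : IsHole (delVerts G S) C) :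
    ∀ v ∈ C, v ∉ S := by
  intro v hv hvS
  have := h.2.1 v hv
  have e : {w ∈ C | (delVerts G S).Adj v w} = ∅ := by
    ext w; simp [del_adj, hvS]
  rw [e, Set.ncard_empty] at this
  omega

theorem del_vv {G : SimpleGraph V} {C S : Set V} (hC : IsShortestEvenHole G C)
    (hS : ∀ v ∈ C, v ∉ S) (hM : ∀ m, IsMajor G C m → m ∈ S) {v1 u v2 : V} (h1 : v1 ∈ C)
    (hu : u ∈ C) (h2 : v2 ∈ C) (h12 : v1 ≠ v2) (a1 : G.Adj v1 u) (a2 : G.Adj u v2) :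
    IsVVHole (delVerts G S) v1 v2 C := by
  have cg := del_congr (G := G) hS
  refine ⟨⟨⟨hole_congr cg hC.1.1, hC.1.2⟩, ?_⟩, ?_, h1, h2, h12, u, hu, a1.ne', a2.ne,
    (cg _ h1 _ hu).1 a1, (cg _ hu _ h2).1 a2⟩
  · intro C' h'
    refine hC.2 C' ⟨hole_congr (fun a ha b hb => (del_congr (del_avoid h'.1) a ha b hb).symm) h'.1,
      h'.2⟩
  · rintro m ⟨m1, a, b, c, ha, hb, hc, ma, mb, mc, ab, bc, ac, nab, nbc, nac⟩
    rw [del_adj] at ma mb mc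
    refine ma.1 (hM m ⟨m1, a, b, c, ha, hb, hc, ma.2.2, mb.2.2, mc.2.2, ab, bc, ac, ?_, ?_, ?_⟩)
    · rwa [cg a ha b hb]
    · rwa [cg b hb c hc]
    · rwa [cg a ha c hc]

theorem exists_maxclique [Finite V] {G : SimpleGraph V} {M : Set V} (hM : G.IsClique M) :
    ∃ K : Set V, M ⊆ K ∧ G.IsClique K ∧ ∀ K', G.IsClique K' → K ⊆ K' → K' = K := by
  obtain ⟨K, h1, h2⟩ := (Set.toFinite {K : Set V | G.IsClique K}).exists_le_maximal hM
  exact ⟨K, h1, h2.prop, fun K' a b => h2.eq_of_ge a b⟩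

/-- Let `G` be 4-hole-free and `C` a shortest even hole of
`G`. Then either `M_G(C) ⊆ N(v)` for a vertex `v` of `C` whose neighbors on `C`
are `v1, v2` and `C` is a `v1v2`-hole of `G − (N(v) ∖ {v1,v2})`, or there is a
maximal clique `K` disjoint from `C` such that `C` is a `v1v2`-hole of `G − K`
for every 3-vertex path of `C` with end-vertices `v1, v2`. -/
theorem shortest_even_hole_tracer
    {V : Type*} [Fintype V] (G : SimpleGraph V)
    (h4free : ∀ C : Set V, IsHole G C → C.ncard ≠ 4)
    (C : Set V) (hC : IsShortestEvenHole G C) :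
    (∃ v ∈ C, ∃ v1 ∈ C, ∃ v2 ∈ C, v1 ≠ v2 ∧ G.Adj v v1 ∧ G.Adj v v2 ∧
        IsVVHole (delVerts G (G.neighborSet v \ {v1, v2})) v1 v2 C) ∨
    (∃ K : Set V, G.IsClique K ∧ (∀ K', G.IsClique K' → K ⊆ K' → K' = K) ∧
        K ∩ C = ∅ ∧
        ∀ v1 u v2 : V, v1 ∈ C → u ∈ C → v2 ∈ C → v1 ≠ v2 →
          G.Adj v1 u → G.Adj u v2 → IsVVHole (delVerts G K) v1 v2 C) := by
  obtain ⟨f, P⟩ := exists_par hC.1.1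
  have K : Ctx G C C.ncard f := ⟨h4free, hC, rfl, P⟩
  by_cases hc : ∃ v ∈ C, ∀ m, IsMajor G C m → G.Adj m v
  · left
    obtain ⟨v, hv, hm⟩ := hc
    obtain ⟨v1, v2, h12, e⟩ := Set.ncard_eq_two.1 (hC.1.1.2.1 v hv)
    have mem : ∀ x, (x ∈ C ∧ G.Adj v x) ↔ (x = v1 ∨ x = v2) := fun x => by
      have := congrArg (x ∈ ·) e
      simpa using this
    have h1 := (mem v1).2 (Or.inl rfl)
    have h2 := (mem v2).2 (Or.inr rfl)
    refine ⟨v, hv, v1, h1.1, v2, h2.1, h12, h1.2, h2.2, ?_⟩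
    refine del_vv hC ?_ ?_ h1.1 hv h2.1 h12 h1.2.symm h2.2
    · rintro x hx ⟨a, b⟩
      exact b ((mem x).1 ⟨hx, a⟩)
    · intro m hmaj
      refine ⟨(hm m hmaj).symm, ?_⟩
      rintro (rfl | rfl)
      · exact hmaj.1 h1.1
      · exact hmaj.1 h2.1
  · right
    push Not at hc
    have hM : G.IsClique {m | IsMajor G C m} := fun x hx y hy hxy => K.main hc hx hy hxy
    obtain ⟨Q, q1, q2, q3⟩ := exists_maxclique hM
    have hQ : ∀ v ∈ C, v ∉ Q := by
      intro v hv hvQ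
      obtain ⟨m, m1, m2⟩ := hc v hv
      exact m2 (q2 (q1 m1) hvQ (fun e => m1.1 (e ▸ hv)))
    refine ⟨Q, q2, q3, ?_, ?_⟩
    · ext v
      simp only [Set.mem_inter_iff, Set.mem_empty_iff_false, iff_false]
      exact fun h => hQ v h.2 h.1
    · intro v1 u v2 h1 hu h2 h12 a1 a2
      exact del_vv hC hQ (fun m hm => q1 hm) h1 hu h2 h12 a1 a2

end OddEven
end
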